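/- arXiv:2011.10855 — 4 statements merged into one kernel-verified Lean document; each statement's English description precedes it below -/
import Mathlib

section
/- Let U ⊆ ℝ^n be the union of two C_b-non-degenerate rectangular boxes R₁, R₂ with a common interior point, with diam(R₁) ≃ diam(R₂) ≃ δ. Then for every polynomial P of degree ≤ m−1 and every y ∈ U, ‖P‖_{L^p(U)} / δ^m is comparable, with constants depending only on m, n, p, C_b, to |P|_{y,δ} = (Σ_{|α| ≤ m−1} |∂^α P(y)|^p δ^{n+(|α|−m)p})^{1/p}. -/
open MeasureTheory

noncomputable section

/-- The partial sum `Σ_{i=1}^k α_i` of a multi-index `α ∈ ℕ^n`. -/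
def partialSum {n : ℕ} (α : Fin n → ℕ) (k : ℕ) : ℕ :=
  ∑ i ∈ Finset.univ.filter (fun i : Fin n => (i : ℕ) < k), α i

/-- The strict order on multi-indices: `α < β` iff at the maximal `k ∈ {0,…,n}` with
`Σ_{i=1}^k α_i ≠ Σ_{i=1}^k β_i` one has `Σ_{i=1}^k α_i < Σ_{i=1}^k β_i`. -/
def MIlt {n : ℕ} (α β : Fin n → ℕ) : Prop :=
  ∃ k ≤ n, partialSum α k < partialSum β k ∧
    ∀ j, k < j → j ≤ n → partialSum α j = partialSum β j

/-- The finite set `M` of multi-indices `α ∈ ℕ^n` of order `|α| ≤ m − 1` (for `m ≥ 1`). -/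
def multiIndices (n m : ℕ) : Finset (Fin n → ℕ) :=
  (Fintype.piFinset fun _ : Fin n => Finset.range m).filter fun α => (∑ i, α i) ≤ m - 1

def mderivList {n : ℕ} : List (Fin n) → MvPolynomial (Fin n) ℝ → MvPolynomial (Fin n) ℝ
  | [], P => P
  | i :: is, P => MvPolynomial.pderiv i (mderivList is P)

/-- The iterated partial derivative `∂^β P` of a polynomial `P` on `ℝ^n`. -/
def mderiv {n : ℕ} (β : Fin n → ℕ) (P : MvPolynomial (Fin n) ℝ) : MvPolynomial (Fin n) ℝ :=
  mderivList ((List.finRange n).flatMap fun i => List.replicate (β i) i) P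

/-- The scaled norm `|P|_{x,δ} = (Σ_{|β| ≤ m−1} |∂^β P(x)|^p δ^{n+(|β|−m)p})^{1/p}`
on polynomials of degree `≤ m − 1`. -/
def pNorm (n m : ℕ) (p : ℝ) (P : MvPolynomial (Fin n) ℝ) (x : Fin n → ℝ) (δ : ℝ) : ℝ :=
  (∑ β ∈ multiIndices n m,
      |MvPolynomial.eval x (mderiv β P)| ^ p *
        δ ^ ((n : ℝ) + ((∑ i, β i : ℕ) : ℝ) * p - (m : ℝ) * p)) ^ (1 / p)

/-- `(P^α)_{α ∈ A}` forms an `(A, x, ε, δ)`-basis for the symmetric convex set `σ`: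
(i) `P^α ∈ ε δ^{n/p+|α|−m} σ`; (ii) `∂^β P^α(x) = δ_{αβ}` for `α, β ∈ A`;
(iii) `|∂^β P^α(x)| ≤ ε δ^{|α|−|β|}` for `α ∈ A` and `β ∈ M` with `β > α`. -/
def IsABasis (n m : ℕ) (p : ℝ) (A : Finset (Fin n → ℕ)) (x : Fin n → ℝ) (ε δ : ℝ)
    (σ : Set (MvPolynomial (Fin n) ℝ)) (P : (Fin n → ℕ) → MvPolynomial (Fin n) ℝ) : Prop :=
  (∀ α ∈ A, ∃ Q ∈ σ,
      P α = (ε * δ ^ ((n : ℝ) / p + ((∑ i, α i : ℕ) : ℝ) - (m : ℝ))) • Q) ∧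
  (∀ α ∈ A, ∀ β ∈ A, MvPolynomial.eval x (mderiv β (P α)) = if α = β then 1 else 0) ∧
  (∀ α ∈ A, ∀ β ∈ multiIndices n m, MIlt α β →
      |MvPolynomial.eval x (mderiv β (P α))| ≤
        ε * δ ^ (((∑ i, α i : ℕ) : ℝ) - ((∑ i, β i : ℕ) : ℝ)))

/-- The closed rectangular box `∏_j [a_j, b_j]` in `ℝ^n`. -/
def box {n : ℕ} (a b : Fin n → ℝ) : Set (Fin n → ℝ) :=
  {x | ∀ i, x i ∈ Set.Icc (a i) (b i)}

open MvPolynomial in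
lemma coeff_mderivList_aux {n : ℕ} (l : List (Fin n)) : ∀ γ : Fin n →₀ ℕ, ∃ c : ℝ, 1 ≤ c ∧
    ∀ Q : MvPolynomial (Fin n) ℝ, coeff γ (mderivList l Q) =
      c * coeff (γ + (l.map fun i => Finsupp.single i 1).sum) Q := by
  induction l with
  | nil => intro γ; exact ⟨1, le_refl _, fun Q => by simp [mderivList]⟩
  | cons i l ih =>
    intro γ
    obtain ⟨c, hc, h⟩ := ih (γ + Finsupp.single i 1)
    refine ⟨c * (γ i + 1), ?_, fun Q => ?_⟩
    · have : (0:ℝ) ≤ γ i := by positivity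
      nlinarith
    · rw [mderivList, coeff_pderiv, h, List.map_cons, List.sum_cons, add_assoc]
      ring

lemma list_sum_aux {n : ℕ} (β : Fin n → ℕ) :
    (((List.finRange n).flatMap fun i => List.replicate (β i) i).map
      fun i => (Finsupp.single i 1 : Fin n →₀ ℕ)).sum = Finsupp.equivFunOnFinite.symm β := by
  have h : ∀ L : List (Fin n), ((L.flatMap fun i => List.replicate (β i) i).map
      fun i => (Finsupp.single i 1 : Fin n →₀ ℕ)).sum
        = (L.map fun i => Finsupp.single i (β i)).sum := by
    intro L
    induction L with
    | nil => simp
    | cons i L ih => simp [List.flatMap_cons, ih]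
  rw [h, ← List.ofFn_eq_map, List.sum_ofFn]
  ext j
  simp [Finsupp.finset_sum_apply, Finsupp.single_apply]

lemma list_length_aux {n : ℕ} (β : Fin n → ℕ) :
    ((List.finRange n).flatMap fun i => List.replicate (β i) i).length = ∑ i, β i := by
  simp [List.length_flatMap, ← List.ofFn_eq_map, List.sum_ofFn]

open MvPolynomial in
lemma mderiv_zero_aux {n : ℕ} (β : Fin n → ℕ) : ∃ c : ℝ, 1 ≤ c ∧
    ∀ Q : MvPolynomial (Fin n) ℝ, eval 0 (mderiv β Q) =
      c * coeff (Finsupp.equivFunOnFinite.symm β) Q := by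
  obtain ⟨c, hc, h⟩ := coeff_mderivList_aux ((List.finRange n).flatMap fun i => List.replicate (β i) i) 0
  refine ⟨c, hc, fun Q => ?_⟩
  have := h Q
  rw [list_sum_aux, zero_add] at this
  rw [← this, mderiv, ← constantCoeff_eq, ← eval_zero]

/-- rescaled polynomial -/
def rescale {n : ℕ} (y : Fin n → ℝ) (δ : ℝ) (P : MvPolynomial (Fin n) ℝ) :
    MvPolynomial (Fin n) ℝ :=
  MvPolynomial.bind₁ (fun i => MvPolynomial.C (y i) + MvPolynomial.C δ * MvPolynomial.X i) P

open MvPolynomial in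
lemma eval_rescale {n : ℕ} (y : Fin n → ℝ) (δ : ℝ) (P : MvPolynomial (Fin n) ℝ) (x : Fin n → ℝ) :
    eval x (rescale y δ P) = eval (y + δ • x) P := by
  have h : (fun i => eval x (C (y i) + C δ * X i)) = y + δ • x := by
    ext i; simp
  rw [rescale, ← coe_aeval_eq_eval, RingHom.coe_coe, aeval_bind₁]
  simp only [coe_aeval_eq_eval, ← h]
  rfl

open MvPolynomial in
lemma pderiv_rescale {n : ℕ} (y : Fin n → ℝ) (δ : ℝ) (i : Fin n) (P : MvPolynomial (Fin n) ℝ) :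
    pderiv i (rescale y δ P) = C δ * rescale y δ (pderiv i P) := by
  unfold rescale
  induction P using MvPolynomial.induction_on with
  | C a => simp
  | add p q hp hq => simp only [map_add, hp, hq, mul_add]
  | mul_X p j hp =>
    simp only [map_mul, Derivation.leibniz, map_add, hp, smul_eq_mul, bind₁_X_right, pderiv_C,
      mul_zero, add_zero, zero_add, pderiv_X, Pi.single_apply]
    by_cases hij : j = i
    · simp [hij]; ring
    · simp [hij]; ring

open MvPolynomial in
lemma mderivList_rescale {n : ℕ} (y : Fin n → ℝ) (δ : ℝ) (l : List (Fin n))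
    (P : MvPolynomial (Fin n) ℝ) :
    mderivList l (rescale y δ P) = C (δ ^ l.length) * rescale y δ (mderivList l P) := by
  induction l with
  | nil => simp [mderivList]
  | cons i l ih =>
    simp only [mderivList, ih, pderiv_C_mul, pderiv_rescale, List.length_cons, pow_succ, map_mul,
      smul_eq_C_mul]
    ring

open MvPolynomial in
lemma eval_mderiv_rescale {n : ℕ} (y : Fin n → ℝ) (δ : ℝ) (β : Fin n → ℕ)
    (P : MvPolynomial (Fin n) ℝ) :
    eval 0 (mderiv β (rescale y δ P)) = δ ^ (∑ i, β i) * eval y (mderiv β P) := by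
  rw [mderiv, mderivList_rescale, list_length_aux, map_mul, eval_C, eval_rescale, mderiv]
  simp

open MvPolynomial in
lemma totalDegree_rescale {n : ℕ} (y : Fin n → ℝ) (δ : ℝ) (P : MvPolynomial (Fin n) ℝ) :
    (rescale y δ P).totalDegree ≤ P.totalDegree := by
  rw [rescale, bind₁, aeval_def, eval₂_eq']
  refine (totalDegree_finsetSum_le (d := P.totalDegree) ?_)
  intro d hd
  refine (totalDegree_mul _ _).trans ?_
  have h1 : (algebraMap ℝ (MvPolynomial (Fin n) ℝ) (coeff d P)).totalDegree = 0 := totalDegree_C _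
  rw [h1, zero_add]
  refine (totalDegree_finsetProd _ _).trans ?_
  refine le_trans ?_ (le_totalDegree hd)
  rw [Finsupp.sum_fintype _ _ (by simp)]
  refine Finset.sum_le_sum fun i _ => ?_
  refine (totalDegree_pow _ _).trans ?_
  have : (C (y i) + C δ * X i : MvPolynomial (Fin n) ℝ).totalDegree ≤ 1 := by
    refine (totalDegree_add _ _).trans (max_le (by simp) ?_)
    refine (totalDegree_mul _ _).trans (by simp)
  nlinarith

/-- polynomial function with given coefficients -/
def pf {n m : ℕ} (q : multiIndices n m → ℝ) (x : Fin n → ℝ) : ℝ :=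
  ∑ β, q β * ∏ i, x i ^ (β.1 i)

lemma mem_multiIndices {n m : ℕ} (hm : 1 ≤ m) (α : Fin n → ℕ) :
    α ∈ multiIndices n m ↔ ∑ i, α i ≤ m - 1 := by
  simp only [multiIndices, Finset.mem_filter, Fintype.mem_piFinset, Finset.mem_range,
    and_iff_right_iff_imp]
  intro h i
  have := Finset.single_le_sum (f := α) (fun _ _ => Nat.zero_le _) (Finset.mem_univ i)
  omega

open MvPolynomial in
lemma eval_eq_pf {n m : ℕ} (hm : 1 ≤ m) (Q : MvPolynomial (Fin n) ℝ) (hQ : Q.totalDegree ≤ m - 1)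
    (x : Fin n → ℝ) :
    eval x Q = pf (fun β : multiIndices n m => coeff (Finsupp.equivFunOnFinite.symm β.1) Q) x := by
  rw [eval_eq', pf]
  rw [Finset.sum_coe_sort (multiIndices n m)
    (fun β => coeff (Finsupp.equivFunOnFinite.symm β) Q * ∏ i, x i ^ (β i))]
  refine Finset.sum_of_injOn (fun d => (d : Fin n → ℕ)) ?_ ?_ ?_ ?_
  · intro a _ b _ h; exact DFunLike.coe_injective h
  · intro d hd
    have := le_totalDegree (Finset.mem_coe.1 hd)
    rw [Finsupp.sum_fintype _ _ (by simp)] at this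
    exact (mem_multiIndices hm _).2 (this.trans hQ)
  · intro β _ hβ
    have : coeff (Finsupp.equivFunOnFinite.symm β) Q = 0 := by
      by_contra h
      exact hβ ⟨Finsupp.equivFunOnFinite.symm β, by simpa using h, by simp⟩
    rw [this, zero_mul]
  · intro d _
    simp

open MvPolynomial in
lemma pf_eq_zero {n m : ℕ} (q : multiIndices n m → ℝ) (w : Fin n → ℝ) (r : ℝ) (hr : 0 < r)
    (h : ∀ z ∈ Set.Icc (0 : Fin n → ℝ) 1, pf q (w + r • z) = 0) : q = 0 := by
  set Q : MvPolynomial (Fin n) ℝ := ∑ β, monomial (Finsupp.equivFunOnFinite.symm β.1) (q β) with hQ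
  have hev : ∀ x, eval x Q = pf q x := by
    intro x
    simp [hQ, pf, eval_monomial, Finsupp.prod_fintype]
  have h0 : Q = 0 := by
    refine funext_set (fun i => Set.Icc (w i) (w i + r)) (fun i => Set.Icc_infinite (by linarith)) ?_
    intro x hx
    rw [map_zero, hev]
    have := h (r⁻¹ • (x - w)) ⟨fun i => ?_, fun i => ?_⟩
    · rwa [smul_inv_smul₀ hr.ne', add_sub_cancel] at this
    · have := (hx i trivial).1
      simp only [Pi.zero_apply, Pi.smul_apply, Pi.sub_apply, smul_eq_mul]
      exact mul_nonneg (by positivity) (by linarith)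
    · have := (hx i trivial).2
      simp only [Pi.one_apply, Pi.smul_apply, Pi.sub_apply, smul_eq_mul]
      rw [inv_mul_le_iff₀ hr]; linarith
  ext β
  have h1 := congrArg (coeff (Finsupp.equivFunOnFinite.symm β.1)) h0
  rw [hQ, coeff_sum, Finset.sum_eq_single β] at h1
  · simpa using h1
  · intro b _ hb
    rw [coeff_monomial, if_neg]
    intro h'
    exact hb (Subtype.ext (Finsupp.equivFunOnFinite.symm.injective h'))
  · simp

lemma key_bound {n m : ℕ} (p : ℝ) (hp : 0 < p) (r K : ℝ) (hr : 0 < r) :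
    ∃ c C : ℝ, 0 < c ∧ 0 < C ∧ ∀ (q : multiIndices n m → ℝ) (w : Fin n → ℝ),
      (∀ i, |w i| ≤ K) →
      c * ‖q‖ ^ p ≤ ∫ z in Set.Icc (0 : Fin n → ℝ) 1, |pf q (w + r • z)| ^ p ∧
      ∫ z in Set.Icc (0 : Fin n → ℝ) 1, |pf q (w + r • z)| ^ p ≤ C * ‖q‖ ^ p := by
  have hcont : Continuous (Function.uncurry fun (qw : (multiIndices n m → ℝ) × (Fin n → ℝ))
      (z : Fin n → ℝ) => |pf qw.1 (qw.2 + r • z)| ^ p) := by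
    refine Continuous.rpow_const ?_ (fun _ => Or.inr hp.le)
    unfold pf
    simp only [Function.uncurry_def, Pi.add_apply, Pi.smul_apply]
    fun_prop
  have hF := continuous_parametric_integral_of_continuous (μ := volume) hcont
    (isCompact_Icc (a := (0 : Fin n → ℝ)) (b := 1))
  set F := fun (qw : (multiIndices n m → ℝ) × (Fin n → ℝ)) =>
    ∫ z in Set.Icc (0 : Fin n → ℝ) 1, |pf qw.1 (qw.2 + r • z)| ^ p with hFdef
  have hS : IsCompact (Metric.sphere (0 : multiIndices n m → ℝ) 1 ×ˢ
      Set.Icc (fun _ : Fin n => -K) (fun _ => K)) := (isCompact_sphere _ _).prod isCompact_Icc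
  have hpos : ∀ x ∈ (Metric.sphere (0 : multiIndices n m → ℝ) 1 ×ˢ
      Set.Icc (fun _ : Fin n => -K) (fun _ => K)), 0 < F x := by
    rintro ⟨q, w⟩ ⟨hq, hw⟩
    have hq1 : ‖q‖ = 1 := by simpa using hq
    have hnn : 0 ≤ F (q, w) := integral_nonneg fun z => by positivity
    refine lt_of_le_of_ne hnn fun h0 => ?_
    have hc : Continuous fun z => |pf q (w + r • z)| ^ p :=
      hcont.comp (f := fun z => ((q, w), z)) (by fun_prop)
    have hae := (setIntegral_eq_zero_iff_of_nonneg_ae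
      (Filter.Eventually.of_forall fun z => by positivity)
      (hc.continuousOn.integrableOn_compact isCompact_Icc)).1 h0.symm
    have heq := Measure.eqOn_of_ae_eq hae hc.continuousOn continuousOn_const (by
      have hcl : Set.Icc (0 : Fin n → ℝ) 1 = Set.univ.pi fun _ => Set.Icc (0:ℝ) 1 :=
        (Set.pi_univ_Icc _ _).symm
      rw [hcl, interior_pi_set Set.finite_univ, closure_pi_set]
      simp)
    have : q = 0 := pf_eq_zero q w r hr fun z hz => by
      have := heq hz
      simp only [Pi.zero_apply] at this
      rw [Real.rpow_eq_zero (abs_nonneg _) hp.ne'] at this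
      exact abs_eq_zero.1 this
    rw [this, norm_zero] at hq1
    exact zero_ne_one hq1
  obtain ⟨c, hc, hcb⟩ := hS.exists_forall_le' hF.continuousOn hpos
  obtain ⟨C, hC⟩ := hS.exists_bound_of_continuousOn hF.continuousOn
  refine ⟨c, |C| + 1, hc, by positivity, fun q w hw => ?_⟩
  by_cases hq : q = 0
  · have h0 : ∀ x, pf (0 : multiIndices n m → ℝ) x = 0 := fun x => by simp [pf]
    simp [hq, h0, Real.zero_rpow hp.ne']
  have hqn : 0 < ‖q‖ := norm_pos_iff.2 hq
  have hmem : (‖q‖⁻¹ • q, w) ∈ (Metric.sphere (0 : multiIndices n m → ℝ) 1 ×ˢ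
      Set.Icc (fun _ : Fin n => -K) (fun _ => K)) := by
    refine ⟨?_, fun i => (abs_le.1 (hw i)).1, fun i => (abs_le.1 (hw i)).2⟩
    simp [norm_smul, hqn.ne']
  have hscale : ∫ z in Set.Icc (0 : Fin n → ℝ) 1, |pf q (w + r • z)| ^ p =
      F (‖q‖⁻¹ • q, w) * ‖q‖ ^ p := by
    rw [hFdef, ← integral_mul_const]
    congr 1
    ext z
    have : pf (‖q‖⁻¹ • q) (w + r • z) = ‖q‖⁻¹ * pf q (w + r • z) := by
      simp [pf, Finset.mul_sum, mul_assoc]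
    simp only [this]
    rw [← Real.mul_rpow (abs_nonneg _) hqn.le, abs_mul, abs_inv, abs_norm]
    congr 1
    field_simp
  rw [hscale]
  have h1 := hcb _ hmem
  have h2 := (le_abs_self _).trans (hC _ hmem)
  have h3 : 0 < ‖q‖ ^ p := by positivity
  exact ⟨by gcongr, by gcongr; exact h2.trans ((le_abs_self C).trans (by linarith))⟩

lemma integral_cube {n : ℕ} (g : (Fin n → ℝ) → ℝ) (a : Fin n → ℝ) (s : ℝ) (hs : 0 < s) :
    ∫ x in box a (fun i => a i + s), g x = s ^ n * ∫ z in Set.Icc (0 : Fin n → ℝ) 1, g (a + s • z) := by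
  have hmeas : MeasurableSet (box a (fun i => a i + s)) := by
    have : box a (fun i => a i + s) = Set.univ.pi fun i => Set.Icc (a i) (a i + s) := by
      ext x; simp only [box, Set.mem_ofPred_eq, Set.mem_univ_pi]
    rw [this]; exact MeasurableSet.univ_pi fun i => measurableSet_Icc
  rw [← integral_indicator hmeas, ← integral_indicator measurableSet_Icc,
    ← integral_add_left_eq_self _ a]
  have h := Measure.integral_comp_smul (volume : Measure (Fin n → ℝ))
    (fun x => (box a (fun i => a i + s)).indicator g (a + x)) s
  have h2 : (fun z => (Set.Icc (0 : Fin n → ℝ) 1).indicator (fun z => g (a + s • z)) z) =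
      fun x => (box a (fun i => a i + s)).indicator g (a + s • x) := by
    ext z
    have : a + s • z ∈ box a (fun i => a i + s) ↔ z ∈ Set.Icc (0 : Fin n → ℝ) 1 := by
      simp only [box, Set.mem_ofPred_eq, Set.mem_Icc, Pi.le_def, ← forall_and, Pi.add_apply,
        Pi.smul_apply, smul_eq_mul, Pi.zero_apply, Pi.one_apply]
      refine forall_congr' fun i => ?_
      constructor
      · rintro ⟨h1, h2⟩; constructor <;> nlinarith
      · rintro ⟨h1, h2⟩; constructor <;> nlinarith
    by_cases hz : z ∈ Set.Icc (0 : Fin n → ℝ) 1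
    · rw [Set.indicator_of_mem hz, Set.indicator_of_mem (this.2 hz)]
    · rw [Set.indicator_of_notMem hz, Set.indicator_of_notMem (fun h => hz (this.1 h))]
  rw [h2, h, Module.finrank_fin_fun, abs_of_pos (by positivity), smul_eq_mul, ← mul_assoc,
    mul_inv_cancel₀ (by positivity), one_mul]

open MvPolynomial in
lemma norm_compare {n m : ℕ} (p : ℝ) (hp : 0 < p) : ∃ D : ℝ, 0 < D ∧
    ∀ Q : MvPolynomial (Fin n) ℝ,
      ‖fun β : multiIndices n m => coeff (Finsupp.equivFunOnFinite.symm β.1) Q‖ ^ p ≤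
        ∑ β ∈ multiIndices n m, |eval 0 (mderiv β Q)| ^ p ∧
      ∑ β ∈ multiIndices n m, |eval 0 (mderiv β Q)| ^ p ≤
        D * ‖fun β : multiIndices n m => coeff (Finsupp.equivFunOnFinite.symm β.1) Q‖ ^ p := by
  choose c hc1 hc using fun β : Fin n → ℕ => mderiv_zero_aux β
  have hc0 : ∀ β, 0 ≤ c β := fun β => zero_le_one.trans (hc1 β)
  refine ⟨∑ β ∈ multiIndices n m, c β ^ p + 1, ?_, fun Q => ?_⟩
  · have : 0 ≤ ∑ β ∈ multiIndices n m, c β ^ p :=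
      Finset.sum_nonneg fun β _ => Real.rpow_nonneg (hc0 β) p
    linarith
  set q := fun β : multiIndices n m => coeff (Finsupp.equivFunOnFinite.symm β.1) Q with hq
  set G := ∑ β ∈ multiIndices n m, |eval 0 (mderiv β Q)| ^ p with hG
  have hG0 : 0 ≤ G := Finset.sum_nonneg fun β _ => by positivity
  constructor
  · have h : ‖q‖ ≤ G ^ p⁻¹ := by
      rw [pi_norm_le_iff_of_nonneg (by positivity)]
      intro β
      rw [Real.le_rpow_inv_iff_of_pos (norm_nonneg _) hG0 hp]
      refine le_trans ?_ (Finset.single_le_sum (f := fun β => |eval 0 (mderiv β Q)| ^ p)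
        (fun _ _ => by positivity) β.2)
      refine Real.rpow_le_rpow (norm_nonneg _) ?_ hp.le
      rw [hc, abs_mul, abs_of_nonneg (hc0 _), Real.norm_eq_abs]
      exact le_mul_of_one_le_left (abs_nonneg _) (hc1 _)
    rwa [Real.le_rpow_inv_iff_of_pos (norm_nonneg _) hG0 hp] at h
  · have hN : 0 ≤ ‖q‖ ^ p := by positivity
    have : G ≤ (∑ β ∈ multiIndices n m, c β ^ p) * ‖q‖ ^ p := by
      rw [Finset.sum_mul]
      refine Finset.sum_le_sum fun β hβ => ?_
      rw [← Real.mul_rpow (hc0 _) (norm_nonneg _)]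
      refine Real.rpow_le_rpow (abs_nonneg _) ?_ hp.le
      rw [hc, abs_mul, abs_of_nonneg (hc0 _)]
      exact mul_le_mul_of_nonneg_left (norm_le_pi_norm q ⟨β, hβ⟩) (hc0 _)
    linarith

lemma pNorm_eq {n m : ℕ} (p : ℝ) (hp : 0 < p) (P : MvPolynomial (Fin n) ℝ) (y : Fin n → ℝ)
    (δ : ℝ) (hδ : 0 < δ) :
    pNorm n m p P y δ = (δ ^ n * (∑ β ∈ multiIndices n m,
      |MvPolynomial.eval 0 (mderiv β (rescale y δ P))| ^ p)) ^ (1 / p) / δ ^ m := by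
  have hpow : (δ ^ m : ℝ) = ((δ ^ m) ^ p) ^ (1 / p) := by
    rw [← Real.rpow_mul (by positivity), mul_one_div_cancel hp.ne', Real.rpow_one]
  rw [hpow, ← Real.div_rpow _ (by positivity), pNorm, Finset.mul_sum, Finset.sum_div]
  · congr 1
    refine Finset.sum_congr rfl fun β _ => ?_
    rw [eval_mderiv_rescale, abs_mul, abs_of_pos (pow_pos hδ (∑ i, β i)),
      Real.mul_rpow (by positivity) (abs_nonneg _), Real.rpow_sub hδ, Real.rpow_add hδ,
      Real.rpow_natCast, Real.rpow_mul hδ.le, Real.rpow_mul hδ.le, Real.rpow_natCast,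
      Real.rpow_natCast]
    ring
  · exact mul_nonneg (by positivity) (Finset.sum_nonneg fun β _ => by positivity)

lemma isCompact_box {n : ℕ} (a b : Fin n → ℝ) : IsCompact (box a b) := by
  have : box a b = Set.univ.pi fun i => Set.Icc (a i) (b i) := by
    ext x; simp only [box, Set.mem_ofPred_eq, Set.mem_univ_pi]
  rw [this]; exact isCompact_univ_pi fun i => isCompact_Icc

lemma cube_rescale {n m : ℕ} (hm : 1 ≤ m) (p : ℝ) (P : MvPolynomial (Fin n) ℝ)
    (hP : P.totalDegree ≤ m - 1) (y a : Fin n → ℝ) (δ r : ℝ) (hδ : 0 < δ) (hr : 0 < r) :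
    ∫ x in box a (fun i => a i + δ * r), |MvPolynomial.eval x P| ^ p =
      (δ * r) ^ n * ∫ z in Set.Icc (0 : Fin n → ℝ) 1,
        |pf (fun β : multiIndices n m => MvPolynomial.coeff (Finsupp.equivFunOnFinite.symm β.1)
          (rescale y δ P)) (δ⁻¹ • (a - y) + r • z)| ^ p := by
  rw [integral_cube _ _ _ (by positivity)]
  simp only [← eval_eq_pf hm _ ((totalDegree_rescale y δ P).trans hP), eval_rescale, smul_add,
    smul_inv_smul₀ hδ.ne', smul_smul]
  simp only [← add_assoc, add_sub_cancel]

/-- **Comparison of `L^p` norm and `|·|_{y,δ}` on a union of two boxes (Lemma `lplem`).**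
Let `U = R₁ ∪ R₂` be a union of two `C_b`-non-degenerate rectangular boxes with a common
interior point, each with diameter (i.e. sidelengths) comparable to `δ`.  Then for every
polynomial `P` of degree `≤ m−1` and every `y ∈ U`,
`‖P‖_{L^p(U)}/δ^m ≃ |P|_{y,δ}` with constants depending only on `m, n, p, C_b`. -/
theorem stmt8 (n m : ℕ) (hn : 1 ≤ n) (hm : 1 ≤ m) (p : ℝ) (hp : (n : ℝ) < p)
    (Cb : ℝ) (hCb : 1 ≤ Cb) :
    ∃ c C : ℝ, 0 < c ∧ 0 < C ∧
      ∀ (a₁ b₁ a₂ b₂ : Fin n → ℝ) (δ : ℝ), 0 < δ →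
        (∀ i, 0 < b₁ i - a₁ i) → (∀ i, 0 < b₂ i - a₂ i) →
        (∀ i i', b₁ i - a₁ i ≤ Cb * (b₁ i' - a₁ i')) →
        (∀ i i', b₂ i - a₂ i ≤ Cb * (b₂ i' - a₂ i')) →
        (∀ i, b₁ i - a₁ i ≤ Cb * δ ∧ δ ≤ Cb * (b₁ i - a₁ i)) →
        (∀ i, b₂ i - a₂ i ≤ Cb * δ ∧ δ ≤ Cb * (b₂ i - a₂ i)) →
        (interior (box a₁ b₁) ∩ interior (box a₂ b₂)).Nonempty →
        ∀ P : MvPolynomial (Fin n) ℝ, P.totalDegree ≤ m - 1 →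
          ∀ y ∈ box a₁ b₁ ∪ box a₂ b₂,
            c * pNorm n m p P y δ ≤
                (∫ x in box a₁ b₁ ∪ box a₂ b₂, |MvPolynomial.eval x P| ^ p) ^ (1 / p) / δ ^ m ∧
            (∫ x in box a₁ b₁ ∪ box a₂ b₂, |MvPolynomial.eval x P| ^ p) ^ (1 / p) / δ ^ m ≤
              C * pNorm n m p P y δ := by
  have hp0 : 0 < p := lt_of_le_of_lt (by positivity) hp
  have hCb0 : 0 < Cb := by linarith
  obtain ⟨c1, C1x, hc1, _, hlow⟩ := key_bound (n := n) (m := m) p hp0 (1 / Cb) (2 * Cb) (by positivity)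
  obtain ⟨c1x, C1, _, hC1, hupp⟩ := key_bound (n := n) (m := m) p hp0 (4 * Cb) (2 * Cb) (by positivity)
  obtain ⟨D, hD, hcmp⟩ := norm_compare (n := n) (m := m) p hp0
  refine ⟨((1 / Cb) ^ n * c1 / D) ^ (1 / p), ((4 * Cb) ^ n * C1) ^ (1 / p), by positivity,
    by positivity, ?_⟩
  intro a₁ b₁ a₂ b₂ δ hδ hp1 hp2 _ _ hd1 hd2 hne P hP y hy
  obtain ⟨w, hw1, hw2⟩ := hne
  replace hw1 := interior_subset hw1
  replace hw2 := interior_subset hw2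
  have hclose : ∀ x ∈ box a₁ b₁ ∪ box a₂ b₂, ∀ i, |x i - w i| ≤ Cb * δ := by
    rintro x (hx | hx) i
    · have h1 := hx i
      have h2 := hw1 i
      have h3 := (hd1 i).1
      rw [abs_le]; constructor <;> linarith [h1.1, h1.2, h2.1, h2.2]
    · have h1 := hx i
      have h2 := hw2 i
      have h3 := (hd2 i).1
      rw [abs_le]; constructor <;> linarith [h1.1, h1.2, h2.1, h2.2]
  have hclose2 : ∀ x ∈ box a₁ b₁ ∪ box a₂ b₂, ∀ i, |x i - y i| ≤ 2 * Cb * δ := by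
    intro x hx i
    have h1 := abs_le.1 (hclose x hx i)
    have h2 := abs_le.1 (hclose y hy i)
    rw [abs_le]; constructor <;> linarith [h1.1, h1.2, h2.1, h2.2]
  have hcont : Continuous fun x => |MvPolynomial.eval x P| ^ p :=
    (MvPolynomial.continuous_eval P).abs.rpow_const fun _ => Or.inr hp0.le
  have hUc : IsCompact (box a₁ b₁ ∪ box a₂ b₂) := (isCompact_box _ _).union (isCompact_box _ _)
  set U := box a₁ b₁ ∪ box a₂ b₂ with hU
  obtain ⟨hg1, hg2⟩ := hcmp (rescale y δ P)
  rw [pNorm_eq p hp0 P y δ hδ]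
  set q := fun β : multiIndices n m => MvPolynomial.coeff (Finsupp.equivFunOnFinite.symm β.1)
          (rescale y δ P) with hq
  set G := ∑ β ∈ multiIndices n m, |MvPolynomial.eval 0 (mderiv β (rescale y δ P))| ^ p with hG
  have hG0 : 0 ≤ G := le_trans (by positivity) hg1
  have hI0 : 0 ≤ ∫ x in U, |MvPolynomial.eval x P| ^ p := integral_nonneg fun x => by positivity
  have ha1 : a₁ ∈ box a₁ b₁ := fun i => ⟨le_refl _, by linarith [hp1 i]⟩
  have hL : (1 / Cb) ^ n * c1 / D * (δ ^ n * G) ≤ ∫ x in U, |MvPolynomial.eval x P| ^ p := by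
    have hsub : box a₁ (fun i => a₁ i + δ * (1 / Cb)) ⊆ U := by
      intro x hx
      refine Or.inl fun i => ⟨(hx i).1, (hx i).2.trans ?_⟩
      have h1 := (hd1 i).2
      have : δ * (1 / Cb) ≤ b₁ i - a₁ i := by
        rw [mul_one_div, div_le_iff₀ hCb0]; linarith
      linarith
    have hmono := setIntegral_mono_set (μ := volume) (hcont.continuousOn.integrableOn_compact hUc)
      (Filter.Eventually.of_forall fun x => by positivity)
      hsub.eventuallyLE
    refine le_trans ?_ hmono
    rw [cube_rescale hm p P hP y a₁ δ (1 / Cb) hδ (by positivity)]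
    have hb := (hlow q (δ⁻¹ • (a₁ - y)) fun i => by
      have := hclose2 a₁ (Or.inl ha1) i
      rw [Pi.smul_apply, Pi.sub_apply, smul_eq_mul, abs_mul, abs_of_pos (by positivity),
        inv_mul_le_iff₀ hδ]
      linarith).1
    calc (1 / Cb) ^ n * c1 / D * (δ ^ n * G)
        ≤ (1 / Cb) ^ n * c1 / D * (δ ^ n * (D * ‖q‖ ^ p)) := by gcongr
      _ = (δ * (1 / Cb)) ^ n * (c1 * ‖q‖ ^ p) := by
        rw [mul_pow]; field_simp
      _ ≤ _ := by gcongr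
  have hR : ∫ x in U, |MvPolynomial.eval x P| ^ p ≤ (4 * Cb) ^ n * C1 * (δ ^ n * G) := by
    set a : Fin n → ℝ := fun i => y i - 2 * Cb * δ with ha
    have hsub : U ⊆ box a (fun i => a i + δ * (4 * Cb)) := by
      intro x hx i
      have := abs_le.1 (hclose2 x hx i)
      simp only [ha, Set.mem_Icc]
      constructor <;> linarith [this.1, this.2]
    have hmono := setIntegral_mono_set (μ := volume) (hcont.continuousOn.integrableOn_compact (isCompact_box _ _))
      (Filter.Eventually.of_forall fun x => by positivity)
      hsub.eventuallyLE
    refine le_trans hmono ?_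
    rw [cube_rescale hm p P hP y a δ (4 * Cb) hδ (by positivity)]
    have hb := (hupp q (δ⁻¹ • (a - y)) fun i => by
      rw [Pi.smul_apply, Pi.sub_apply, smul_eq_mul, abs_mul, abs_of_pos (by positivity),
        inv_mul_le_iff₀ hδ, ha, abs_le]
      have : 0 < Cb * δ := by positivity
      constructor <;> linarith).2
    calc _ ≤ (δ * (4 * Cb)) ^ n * (C1 * ‖q‖ ^ p) := by gcongr
      _ ≤ (δ * (4 * Cb)) ^ n * (C1 * G) := by gcongr
      _ = _ := by rw [mul_pow]; ring
  constructor
  · rw [← mul_div_assoc, ← Real.mul_rpow (by positivity) (by positivity)]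
    gcongr
  · rw [← mul_div_assoc, ← Real.mul_rpow (by positivity) (by positivity)]
    gcongr

end
end

section
/- If the multi-index set A is nonempty, then the set K_p of keystone points has Lebesgue measure zero. -/
open MeasureTheory
open scoped ENNReal

noncomputable section

/-- The partial derivative `∂_i f` of a function on `ℝ^n` (via the Fréchet derivative). -/
def pdIdx (n : ℕ) (i : Fin n) (f : (Fin n → ℝ) → ℝ) : (Fin n → ℝ) → ℝ :=
  fun x => fderiv ℝ f x (Pi.single i 1)

def pdList (n : ℕ) : List (Fin n) → ((Fin n → ℝ) → ℝ) → ((Fin n → ℝ) → ℝ)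
  | [], f => f
  | i :: is, f => pdIdx n i (pdList n is f)

/-- The iterated partial derivative `∂^α f` of a function on `ℝ^n`. -/
def pdAlpha (n : ℕ) (α : Fin n → ℕ) (f : (Fin n → ℝ) → ℝ) : (Fin n → ℝ) → ℝ :=
  pdList n ((List.finRange n).flatMap fun i => List.replicate (α i) i) f

/-- The `(m−1)`-jet (degree-`(m−1)` Taylor polynomial) of a function `F` at `y ∈ ℝ^n`. -/
def jet (n m : ℕ) (F : (Fin n → ℝ) → ℝ) (y : Fin n → ℝ) : MvPolynomial (Fin n) ℝ :=
  ∑ α ∈ multiIndices n m,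
    MvPolynomial.C (pdAlpha n α F y / ∏ i, (Nat.factorial (α i) : ℝ)) *
      ∏ i, (MvPolynomial.X i - MvPolynomial.C (y i)) ^ α i

/-- The homogeneous Sobolev seminorm `max_{|α| = m} ‖∂^α F‖_{L^p(ℝ^n)}`, valued in `ℝ≥0∞`. -/
def sobE (n m : ℕ) (p : ℝ) (F : (Fin n → ℝ) → ℝ) : ℝ≥0∞ :=
  ⨆ α : {α : Fin n → ℕ // (∑ i, α i) = m},
    eLpNorm (pdAlpha n α.1 F) (ENNReal.ofReal p) volume

/-- The symmetric convex set of jets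
`σ_J(x, μ) = {J_x F : F ∈ L^{m,p}(ℝ^n), ‖F‖_{L^{m,p}}^p + ∫ |F|^p dμ ≤ 1}`. -/
def sigmaJ (n m : ℕ) (p : ℝ) (μ : Measure (Fin n → ℝ)) (x : Fin n → ℝ) :
    Set (MvPolynomial (Fin n) ℝ) :=
  {P | ∃ F : (Fin n → ℝ) → ℝ, ContDiff ℝ (⊤ : ℕ∞) F ∧ jet n m F x = P ∧
      sobE n m p F ^ p + ∫⁻ y, ENNReal.ofReal (|F y| ^ p) ∂μ ≤ 1}

/-- A dyadic cube `∏_i (j_i 2^k, (j_i+1) 2^k]` in `ℝ^n`, recorded by its scale `k` and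
its integer coordinates `j`. -/
structure DyadicCube (n : ℕ) where
  k : ℤ
  j : Fin n → ℤ

namespace DyadicCube

/-- The sidelength `2^k` of a dyadic cube. -/
def sidelength {n : ℕ} (Q : DyadicCube n) : ℝ := 2 ^ Q.k

/-- The underlying (half-open) set of a dyadic cube. -/
def toSet {n : ℕ} (Q : DyadicCube n) : Set (Fin n → ℝ) :=
  {x | ∀ i, (Q.j i : ℝ) * 2 ^ Q.k < x i ∧ x i ≤ ((Q.j i : ℝ) + 1) * 2 ^ Q.k}

/-- The center of a dyadic cube. -/
def center {n : ℕ} (Q : DyadicCube n) : Fin n → ℝ :=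
  fun i => ((Q.j i : ℝ) + 1 / 2) * 2 ^ Q.k

/-- The concentric dilate `cQ` of a dyadic cube `Q` (as a closed cube). -/
def dilate {n : ℕ} (Q : DyadicCube n) (c : ℝ) : Set (Fin n → ℝ) :=
  {x | ∀ i, |x i - Q.center i| ≤ c * Q.sidelength / 2}

end DyadicCube

/-- The unit cube `Q° = (0,1]^n` as a dyadic cube. -/
def unitCube (n : ℕ) : DyadicCube n := ⟨0, fun _ => 0⟩

/-- Monotonicity of the `OK` predicate: if `Q, Q'` are dyadic subcubes of `Q°`, `Q'` is OK and
`3Q ⊆ 3Q'`, then `Q` is OK. -/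
def OKmono {n : ℕ} (OK : DyadicCube n → Prop) : Prop :=
  ∀ Q Q' : DyadicCube n, Q.toSet ⊆ (unitCube n).toSet → Q'.toSet ⊆ (unitCube n).toSet →
    OK Q' → Q.dilate 3 ⊆ Q'.dilate 3 → OK Q

/-- A Calderón–Zygmund cube: an OK dyadic subcube of `Q°` such that every dyadic subcube of
`Q°` properly containing it is not OK. -/
def CZ {n : ℕ} (OK : DyadicCube n → Prop) (Q : DyadicCube n) : Prop :=
  Q.toSet ⊆ (unitCube n).toSet ∧ OK Q ∧
    ∀ Q' : DyadicCube n, Q'.toSet ⊆ (unitCube n).toSet → Q.toSet ⊂ Q'.toSet → ¬ OK Q'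

/-- A keystone cube: a CZ cube `Q` such that every CZ cube meeting `100Q` has sidelength
at least that of `Q`. -/
def Keystone {n : ℕ} (OK : DyadicCube n → Prop) (Q : DyadicCube n) : Prop :=
  CZ OK Q ∧ ∀ Q' : DyadicCube n, CZ OK Q' → (Q'.toSet ∩ Q.dilate 100).Nonempty →
    Q.sidelength ≤ Q'.sidelength

/-- The union of all CZ cubes. -/
def KCZ {n : ℕ} (OK : DyadicCube n → Prop) : Set (Fin n → ℝ) :=
  ⋃ (Q : DyadicCube n) (_ : CZ OK Q), Q.toSet

/-- The set of keystone points `K_p = Q° \ ⋃ {Q : Q CZ}`. -/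
def Kp {n : ℕ} (OK : DyadicCube n → Prop) : Set (Fin n → ℝ) :=
  (unitCube n).toSet \ KCZ OK

open Metric Filter Topology Set Pointwise in
/-- A function vanishing on `s` has zero derivative at the density points of `s`. -/
lemma fderiv_eq_zero_of_density {n : ℕ} (s : Set (Fin n → ℝ)) (x : Fin n → ℝ) (xs : x ∈ s)
    (hx : Tendsto (fun r => volume (s ∩ closedBall x r) / volume (closedBall x r))
      (𝓝[>] 0) (𝓝 1)) (g : (Fin n → ℝ) → ℝ) (hg : DifferentiableAt ℝ g x)
    (h0 : ∀ y ∈ s, g y = 0) : fderiv ℝ g x = 0 := by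
  ext1 z
  set L := fderiv ℝ g x with hL
  have key : ∀ ε : ℝ, 0 < ε → ‖L z‖ ≤ ε * (‖z‖ + ε) + ‖L‖ * ε := by
    intro ε εpos
    have B₁ : ∀ᶠ r in 𝓝[>] (0 : ℝ), (s ∩ ({x} + r • closedBall z ε)).Nonempty :=
      Measure.eventually_nonempty_inter_smul_of_density_one volume s x hx _ measurableSet_closedBall
        (measure_closedBall_pos volume z εpos).ne'
    obtain ⟨ρ, ρpos, hρ⟩ :
        ∃ ρ > 0, ball x ρ ⊆ {y | ‖g y - g x - L (y - x)‖ ≤ ε * ‖y - x‖} :=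
      mem_nhds_iff.1 (hg.hasFDerivAt.isLittleO.def εpos)
    have B₂ : ∀ᶠ r in 𝓝[>] (0 : ℝ), {x} + r • closedBall z ε ⊆ ball x ρ := by
      apply nhdsWithin_le_nhds
      exact eventually_singleton_add_smul_subset isBounded_closedBall (ball_mem_nhds x ρpos)
    obtain ⟨r, ⟨y, ⟨ys, hy⟩⟩, rρ, rpos⟩ :
        ∃ r : ℝ, (s ∩ ({x} + r • closedBall z ε)).Nonempty ∧
          {x} + r • closedBall z ε ⊆ ball x ρ ∧ 0 < r :=
      (B₁.and (B₂.and self_mem_nhdsWithin)).exists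
    have hyρ := hρ (rρ hy)
    obtain ⟨a, az, ya⟩ : ∃ a, a ∈ closedBall z ε ∧ y = x + r • a := by
      simp only [mem_smul_set, image_add_left, mem_preimage, singleton_add] at hy
      rcases hy with ⟨a, az, ha⟩
      exact ⟨a, az, by simp only [ha, add_neg_cancel_left]⟩
    have haz : ‖a - z‖ ≤ ε := mem_closedBall_iff_norm.1 az
    have norm_a : ‖a‖ ≤ ‖z‖ + ε := by
      have := norm_add_le z (a - z)
      rw [add_sub_cancel] at this
      linarith
    have h1 : ‖L a‖ ≤ ε * ‖a‖ := by
      have h2 : ‖g y - g x - L (y - x)‖ ≤ ε * ‖y - x‖ := hyρ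
      rw [h0 y ys, h0 x xs, ya, add_sub_cancel_left, sub_zero, zero_sub, norm_neg, map_smul,
        norm_smul, norm_smul, Real.norm_eq_abs, abs_of_pos rpos] at h2
      have : r * ‖L a‖ ≤ r * (ε * ‖a‖) := by linarith
      exact le_of_mul_le_mul_left this rpos
    have h3 : L z = L a - L (a - z) := by simp
    calc ‖L z‖ ≤ ‖L a‖ + ‖L (a - z)‖ := by rw [h3]; exact norm_sub_le _ _
      _ ≤ ε * (‖z‖ + ε) + ‖L‖ * ε := by
        have := L.le_opNorm (a - z)
        gcongr
        · exact h1.trans (by gcongr)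
        · exact this.trans (by gcongr)
  have lim : Tendsto (fun ε : ℝ => ε * (‖z‖ + ε) + ‖L‖ * ε) (𝓝[>] 0)
      (𝓝 (0 * (‖z‖ + 0) + ‖L‖ * 0)) := by
    apply Tendsto.mono_left _ nhdsWithin_le_nhds
    exact Continuous.tendsto (by fun_prop) 0
  have := ge_of_tendsto lim (by
    filter_upwards [self_mem_nhdsWithin] with ε hε using key ε hε)
  simp only [zero_mul, mul_zero, add_zero] at this
  simpa using this

open Metric Filter Topology Set in
/-- Any set of positive measure contains a nonempty set which has density one at all its
points. -/
lemma exists_density_subset {n : ℕ} (K : Set (Fin n → ℝ)) (hK : volume K ≠ 0) :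
    ∃ s ⊆ K, s.Nonempty ∧ ∀ x ∈ s,
      Tendsto (fun r => volume (s ∩ closedBall x r) / volume (closedBall x r))
        (𝓝[>] 0) (𝓝 1) := by
  set D : Set (Fin n → ℝ) := {x | Tendsto (fun r => volume (K ∩ closedBall x r) /
    volume (closedBall x r)) (𝓝[>] 0) (𝓝 1)} with hD
  have hae : ∀ᵐ x ∂(volume.restrict K), x ∈ D := Besicovitch.ae_tendsto_measure_inter_div volume K
  obtain ⟨T, hTD, hTm, hT0⟩ : ∃ T : Set (Fin n → ℝ), Dᶜ ⊆ T ∧ MeasurableSet T ∧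
      volume.restrict K T = 0 := exists_measurable_superset_of_null (mem_ae_iff.1 hae)
  have hnull : volume (K \ D) = 0 := by
    rw [Measure.restrict_apply hTm] at hT0
    refine measure_mono_null ?_ hT0
    exact fun x hx => ⟨hTD hx.2, hx.1⟩
  refine ⟨K ∩ D, inter_subset_left, ?_, ?_⟩
  · by_contra h
    rw [not_nonempty_iff_eq_empty] at h
    apply hK
    rw [← hnull]
    congr 1
    ext x
    constructor
    · exact fun hx => ⟨hx, fun hd => by have : x ∈ K ∩ D := ⟨hx, hd⟩; rw [h] at this; exact this⟩
    · exact fun hx => hx.1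
  · intro x hx
    have hx2 : Tendsto (fun r => volume (K ∩ closedBall x r) /
      volume (closedBall x r)) (𝓝[>] 0) (𝓝 1) := hx.2
    refine hx2.congr fun r => ?_
    congr 1
    apply le_antisymm
    · calc volume (K ∩ closedBall x r)
          ≤ volume ((K ∩ D ∩ closedBall x r) ∪ (K \ D)) := by
            apply measure_mono
            intro y hy
            by_cases hd : y ∈ D
            · exact Or.inl ⟨⟨hy.1, hd⟩, hy.2⟩
            · exact Or.inr ⟨hy.1, hd⟩
        _ ≤ _ := by
            refine (measure_union_le _ _).trans ?_
            rw [hnull, add_zero]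
    · exact measure_mono (inter_subset_inter_left _ inter_subset_left)

lemma contDiff_pdList {n : ℕ} (l : List (Fin n)) (F : (Fin n → ℝ) → ℝ)
    (hF : ContDiff ℝ (⊤ : ℕ∞) F) : ContDiff ℝ (⊤ : ℕ∞) (pdList n l F) := by
  induction l with
  | nil => exact hF
  | cons i is ih =>
    show ContDiff ℝ (⊤ : ℕ∞) (fun x => fderiv ℝ (pdList n is F) x (Pi.single i 1))
    exact (ih.fderiv_right (m := (⊤ : ℕ∞)) (by simp)).clm_apply contDiff_const

open Metric Filter Topology Set in
lemma pdList_eq_zero {n : ℕ} (s : Set (Fin n → ℝ))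
    (hs : ∀ x ∈ s, Tendsto (fun r => volume (s ∩ closedBall x r) / volume (closedBall x r))
        (𝓝[>] 0) (𝓝 1)) (l : List (Fin n)) (F : (Fin n → ℝ) → ℝ)
    (hF : ContDiff ℝ (⊤ : ℕ∞) F) (h0 : ∀ y ∈ s, F y = 0) : ∀ y ∈ s, pdList n l F y = 0 := by
  induction l with
  | nil => exact h0
  | cons i is ih =>
    intro y hy
    show fderiv ℝ (pdList n is F) y (Pi.single i 1) = 0
    rw [fderiv_eq_zero_of_density s y hy (hs y hy) _
      ((contDiff_pdList is F hF).differentiable (by simp) y) ih]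
    rfl

lemma mderivList_zero {n : ℕ} (l : List (Fin n)) : mderivList l 0 = 0 := by
  induction l with
  | nil => rfl
  | cons i is ih => simp [mderivList, ih]

/-- The dyadic cube of sidelength `2^{-N}` containing `x`. -/
def dyAt {n : ℕ} (x : Fin n → ℝ) (N : ℕ) : DyadicCube n :=
  ⟨-(N : ℤ), fun i => ⌈x i * 2 ^ N⌉ - 1⟩

lemma mem_dyAt {n : ℕ} (x : Fin n → ℝ) (N : ℕ) : x ∈ (dyAt x N).toSet := by
  intro i
  have h2 : (0 : ℝ) < 2 ^ N := by positivity
  simp only [dyAt, zpow_neg, zpow_natCast]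
  push_cast
  rw [← div_eq_mul_inv, ← div_eq_mul_inv, div_lt_iff₀ h2, le_div_iff₀ h2]
  constructor
  · linarith [Int.ceil_lt_add_one (x i * 2 ^ N)]
  · linarith [Int.le_ceil (x i * 2 ^ N)]

lemma dyAt_subset {n : ℕ} (x : Fin n → ℝ) (hx : x ∈ (unitCube n).toSet) (N : ℕ) :
    (dyAt x N).toSet ⊆ (unitCube n).toSet := by
  intro y hy i
  have h2 : (0 : ℝ) < 2 ^ N := by positivity
  have hyi := hy i
  have hxi := hx i
  simp only [unitCube, zpow_zero, Int.cast_zero] at hxi ⊢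
  simp only [dyAt, zpow_neg, zpow_natCast] at hyi
  push_cast at hyi
  rw [← div_eq_mul_inv, ← div_eq_mul_inv, div_lt_iff₀ h2, le_div_iff₀ h2] at hyi
  have c1 : (1 : ℤ) ≤ ⌈x i * 2 ^ N⌉ := Int.one_le_ceil_iff.2 (mul_pos (by linarith [hxi.1]) h2)
  have c2 : ⌈x i * 2 ^ N⌉ ≤ (2 : ℤ) ^ N := by
    rw [Int.ceil_le]; push_cast
    nlinarith [hxi.2]
  have c1' : (1 : ℝ) ≤ (⌈x i * 2 ^ N⌉ : ℝ) := by exact_mod_cast c1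
  have c2' : (⌈x i * 2 ^ N⌉ : ℝ) ≤ (2 : ℝ) ^ N := by exact_mod_cast c2
  constructor
  · have : 0 < y i * 2 ^ N := by linarith [hyi.1]
    have := pos_of_mul_pos_left this h2.le
    linarith
  · have : y i * 2 ^ N ≤ 1 * 2 ^ N := by linarith [hyi.2]
    have := le_of_mul_le_mul_right this h2
    linarith

lemma eq_dyAt {n : ℕ} (x : Fin n → ℝ) (Q : DyadicCube n) (hx : x ∈ Q.toSet) (N : ℕ)
    (hk : Q.k = -(N : ℤ)) : Q = dyAt x N := by
  obtain ⟨k, j⟩ := Q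
  simp only at hk
  subst hk
  simp only [dyAt]
  congr 1
  funext i
  have hxi := hx i
  have h2 : (0 : ℝ) < 2 ^ N := by positivity
  simp only [zpow_neg, zpow_natCast] at hxi
  rw [← div_eq_mul_inv, ← div_eq_mul_inv, div_lt_iff₀ h2, le_div_iff₀ h2] at hxi
  have : ⌈x i * 2 ^ N⌉ = j i + 1 := by
    rw [Int.ceil_eq_iff]; push_cast
    exact ⟨by linarith [hxi.1], hxi.2⟩
  omega

lemma k_le_of_subset {n : ℕ} (hn : 1 ≤ n) (Q Q' : DyadicCube n) (h : Q.toSet ⊆ Q'.toSet) :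
    Q.k ≤ Q'.k := by
  have hi : 0 < n := hn
  let i : Fin n := ⟨0, hi⟩
  have h2 : (0 : ℝ) < 2 ^ Q.k := by positivity
  have hpt : ∀ t : ℝ, 0 < t → t ≤ 1 → (fun i => ((Q.j i : ℝ) + t) * 2 ^ Q.k) ∈ Q'.toSet := by
    intro t ht ht1
    apply h
    intro i
    constructor
    · show (Q.j i : ℝ) * 2 ^ Q.k < ((Q.j i : ℝ) + t) * 2 ^ Q.k
      nlinarith
    · show ((Q.j i : ℝ) + t) * 2 ^ Q.k ≤ ((Q.j i : ℝ) + 1) * 2 ^ Q.k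
      nlinarith
  have hup := (hpt 1 one_pos le_rfl i).2
  have hlo : (Q'.j i : ℝ) * 2 ^ Q'.k ≤ (Q.j i : ℝ) * 2 ^ Q.k := by
    by_contra hc
    push Not at hc
    set d := (Q'.j i : ℝ) * 2 ^ Q'.k - (Q.j i : ℝ) * 2 ^ Q.k with hd
    have hdpos : 0 < d := by linarith
    have h3 := (hpt (min 1 (d / 2 ^ Q.k)) (by positivity) (min_le_left _ _) i).1
    have h4 : min 1 (d / 2 ^ Q.k) * 2 ^ Q.k ≤ d := by
      calc min 1 (d / 2 ^ Q.k) * 2 ^ Q.k ≤ d / 2 ^ Q.k * 2 ^ Q.k := by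
            gcongr; exact min_le_right _ _
        _ = d := by field_simp
    simp only at h3
    nlinarith
  have : (2 : ℝ) ^ Q.k ≤ 2 ^ Q'.k := by
    simp only at hup
    nlinarith
  exact (zpow_le_zpow_iff_right₀ (by norm_num : (1 : ℝ) < 2)).1 this

lemma not_OK_of_mem_Kp {n : ℕ} (hn : 1 ≤ n) (OK : DyadicCube n → Prop) (x : Fin n → ℝ)
    (hx : x ∈ Kp OK) (N : ℕ) : ¬ OK (dyAt x N) := by
  classical
  intro hN
  obtain ⟨N₀, hN₀, hmin⟩ : ∃ N₀, OK (dyAt x N₀) ∧ ∀ N', OK (dyAt x N') → N₀ ≤ N' := by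
    have hex : ∃ N, OK (dyAt x N) := ⟨N, hN⟩
    exact ⟨Nat.find hex, Nat.find_spec hex, fun N' h => Nat.find_min' hex h⟩
  apply hx.2
  refine Set.mem_iUnion₂.2 ⟨dyAt x N₀, ⟨dyAt_subset x hx.1 _, hN₀, ?_⟩,
    mem_dyAt x _⟩
  intro Q' hQ' hss hOK
  have h1 := k_le_of_subset hn _ _ hss.1
  have h2 := k_le_of_subset hn _ _ hQ'
  simp only [dyAt] at h1
  simp only [unitCube] at h2
  obtain ⟨N', hN'⟩ : ∃ N' : ℕ, Q'.k = -(N' : ℤ) := ⟨(-Q'.k).toNat, by omega⟩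
  have he := eq_dyAt x Q' (hss.1 (mem_dyAt x _)) N' hN'
  have hle : N₀ ≤ N' := hmin N' (he ▸ hOK)
  have heq : N' = N₀ := by omega
  apply hss.2
  rw [he, heq]

open Metric in
lemma dilate_subset_ball {n : ℕ} (x : Fin n → ℝ) (N : ℕ) :
    (dyAt x N).dilate 3 ⊆ closedBall x (2 * (2 ^ N)⁻¹) := by
  intro y hy
  rw [mem_closedBall, dist_pi_le_iff (by positivity)]
  intro i
  have h1 := hy i
  have h2 := mem_dyAt x N i
  simp only [DyadicCube.sidelength, DyadicCube.center, dyAt, zpow_neg, zpow_natCast] at h1 h2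
  rw [Real.dist_eq, abs_le]
  rw [abs_le] at h1
  constructor <;> linarith [h1.1, h1.2, h2.1, h2.2]

open Metric Filter Topology in
lemma measure_ball_top {n m : ℕ} (hn : 1 ≤ n) (hm : 1 ≤ m) (p : ℝ) (hp : (n : ℝ) < p)
    (c : ℝ) (hc : 0 < c) (μ : Measure (Fin n → ℝ)) (OK : DyadicCube n → Prop)
    (hOK : ∀ Q : DyadicCube n, Q.toSet ⊆ (unitCube n).toSet →
          μ (Q.dilate 3) ≤
            ENNReal.ofReal (c * (30 * Q.sidelength) ^ ((n : ℝ) - (m : ℝ) * p)) →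
          OK Q)
    (x : Fin n → ℝ) (hx : x ∈ Kp OK) (η : ℝ) (hη : 0 < η) : μ (closedBall x η) = ∞ := by
  have hlim0 : Tendsto (fun N : ℕ => ((2 : ℝ) ^ N)⁻¹) atTop (𝓝[>] 0) := by
    rw [tendsto_nhdsWithin_iff]
    refine ⟨?_, Eventually.of_forall fun N => by simp only [Set.mem_Ioi]; positivity⟩
    exact tendsto_inv_atTop_zero.comp (tendsto_pow_atTop_atTop_of_one_lt (by norm_num))
  have hneg : (n : ℝ) - (m : ℝ) * p < 0 := by
    have : (1 : ℝ) ≤ m := by exact_mod_cast hm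
    have : (0 : ℝ) ≤ n := by positivity
    nlinarith
  have hlim : Tendsto (fun N : ℕ => c * (30 * ((2 : ℝ) ^ N)⁻¹) ^ ((n : ℝ) - (m : ℝ) * p))
      atTop atTop := by
    apply Tendsto.const_mul_atTop hc
    have h1 : Tendsto (fun N : ℕ => 30 * ((2 : ℝ) ^ N)⁻¹) atTop (𝓝[>] 0) := by
      rw [tendsto_nhdsWithin_iff] at hlim0 ⊢
      refine ⟨by simpa using hlim0.1.const_mul 30,
        Eventually.of_forall fun N => by simp only [Set.mem_Ioi]; positivity⟩
    exact (tendsto_rpow_neg_nhdsGT_zero hneg).comp h1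
  have hsmall : ∀ᶠ N : ℕ in atTop, 2 * ((2 : ℝ) ^ N)⁻¹ ≤ η := by
    have h1 : Tendsto (fun N : ℕ => 2 * ((2 : ℝ) ^ N)⁻¹) atTop (𝓝 0) := by
      simpa using (tendsto_nhdsWithin_iff.1 hlim0).1.const_mul 2
    exact h1.eventually_le_const hη
  have hlim' := ENNReal.tendsto_ofReal_atTop.comp hlim
  refine top_le_iff.1 (le_of_tendsto hlim' ?_)
  filter_upwards [hsmall] with N hN
  have h1 : ¬ _ := fun h => not_OK_of_mem_Kp hn OK x hx N (hOK _ (dyAt_subset x hx.1 N) h)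
  rw [not_le] at h1
  have h2 : (dyAt x N).sidelength = ((2 : ℝ) ^ N)⁻¹ := by
    simp [DyadicCube.sidelength, dyAt]
  rw [h2] at h1
  exact h1.le.trans (measure_mono ((dilate_subset_ball x N).trans (closedBall_subset_closedBall hN)))

open Metric Filter Topology in
lemma vanish_of_top {n : ℕ} (p : ℝ) (hp : 0 < p) (μ : Measure (Fin n → ℝ)) (x : Fin n → ℝ)
    (hx : ∀ η : ℝ, 0 < η → μ (closedBall x η) = ∞) (F : (Fin n → ℝ) → ℝ) (hF : Continuous F)
    (hint : ∫⁻ y, ENNReal.ofReal (|F y| ^ p) ∂μ ≤ 1) : F x = 0 := by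
  by_contra hne
  have hpos : 0 < |F x| := abs_pos.2 hne
  have hev : ∀ᶠ y in 𝓝 x, |F x| / 2 < |F y| :=
    hF.abs.continuousAt.eventually_const_lt (by linarith)
  obtain ⟨η, hη, hball⟩ := nhds_basis_closedBall.eventually_iff.1 hev
  have hcp : 0 < (|F x| / 2) ^ p := by positivity
  have h1 : ∫⁻ _ in closedBall x η, ENNReal.ofReal ((|F x| / 2) ^ p) ∂μ ≤
      ∫⁻ y, ENNReal.ofReal (|F y| ^ p) ∂μ := by
    refine le_trans ?_ (setLIntegral_le_lintegral (closedBall x η) _)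
    refine setLIntegral_mono' measurableSet_closedBall fun y hy => ?_
    exact ENNReal.ofReal_le_ofReal
      (Real.rpow_le_rpow (by positivity) (hball hy).le hp.le)
  rw [setLIntegral_const, hx η hη, ENNReal.mul_top (by simpa using hcp)] at h1
  exact absurd (h1.trans hint) (by simp)

/-- **If the label `A` is nonempty, the keystone set has Lebesgue measure zero
(Lemma `measkplem`).**  Setup: `n < p < ∞`, `m ≥ 1`, `A ⊆ M` monotonic and nonempty, `μ` a
measure with `supp μ ⊆ (1/10)Q°`, `OK` monotone and containing all dyadic subcubes `Q` of `Q°`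
with `μ(3Q) ≤ (ε₀/C₀)^p (30δ_Q)^{n−mp}` (so that every keystone point has
`μ(B(x,η)) = ∞`).  If, for a sufficiently small `ε`, each `x ∈ Q°` admits a family
`(P_x^α)_{α∈A}` forming an `(A, x, Cε, 1)`-basis for `σ_J(x,μ)` with
`|∂^β P_x^α(x)| ≤ C`, then `|K_p| = 0`. -/
theorem stmt14 (n m : ℕ) (hn : 1 ≤ n) (hm : 1 ≤ m) (p : ℝ) (hp : (n : ℝ) < p)
    (Cb : ℝ) (hCb : 0 < Cb) :
    ∃ ε₁ : ℝ, 0 < ε₁ ∧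
      ∀ ε ε₀ C₀ : ℝ, 0 < ε → ε ≤ ε₁ → 0 < ε₀ → 0 < C₀ →
      ∀ (μ : Measure (Fin n → ℝ)) (OK : DyadicCube n → Prop),
        OKmono OK →
        μ (((unitCube n).dilate (1 / 10))ᶜ) = 0 →
        (∀ Q : DyadicCube n, Q.toSet ⊆ (unitCube n).toSet →
          μ (Q.dilate 3) ≤
            ENNReal.ofReal ((ε₀ / C₀) ^ p * (30 * Q.sidelength) ^ ((n : ℝ) - (m : ℝ) * p)) →
          OK Q) →
      ∀ A : Finset (Fin n → ℕ), A.Nonempty → (∀ α ∈ A, (∑ i, α i) ≤ m - 1) →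
        (∀ α ∈ A, ∀ γ : Fin n → ℕ, (∑ i, (α + γ) i) ≤ m - 1 → α + γ ∈ A) →
        (∀ x ∈ (unitCube n).toSet, ∃ P : (Fin n → ℕ) → MvPolynomial (Fin n) ℝ,
          IsABasis n m p A x (Cb * ε) 1 (sigmaJ n m p μ x) P ∧
          ∀ α ∈ A, ∀ β ∈ multiIndices n m,
            |MvPolynomial.eval x (mderiv β (P α))| ≤ Cb) →
        volume (Kp OK) = 0 := by
  refine ⟨1, one_pos, ?_⟩
  intro ε ε₀ C₀ hε _ hε₀ hC₀ μ OK _ _ hOK A hA _ _ hbasis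
  have hp0 : 0 < p := lt_of_le_of_lt (Nat.cast_nonneg n) hp
  by_contra hvol
  obtain ⟨s, hsK, ⟨x, hxs⟩, hs⟩ := exists_density_subset (Kp OK) hvol
  obtain ⟨α, hα⟩ := hA
  obtain ⟨P, ⟨hP1, hP2, -⟩, -⟩ := hbasis x (hsK hxs).1
  obtain ⟨Q, ⟨F, hF, hjet, hnorm⟩, hPQ⟩ := hP1 α hα
  have hint : ∫⁻ y, ENNReal.ofReal (|F y| ^ p) ∂μ ≤ 1 := le_add_self.trans hnorm
  have h0 : ∀ y ∈ s, F y = 0 := fun y hy =>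
    vanish_of_top p hp0 μ y (fun η hη => measure_ball_top hn hm p hp ((ε₀ / C₀) ^ p)
      (by positivity) μ OK hOK y (hsK hy) η hη) F hF.continuous hint
  have hj : jet n m F x = 0 := by
    unfold jet
    refine Finset.sum_eq_zero fun β _ => ?_
    have : pdAlpha n β F x = 0 := pdList_eq_zero s hs _ F hF h0 x hxs
    simp [this]
  have hP0 : P α = 0 := by rw [hPQ, ← hjet, hj, smul_zero]
  have h1 := hP2 α hα α hα
  rw [hP0, mderiv, mderivList_zero] at h1
  simp at h1

end
end

section
/- Chains to keystone cubes or keystone points: there exist universal constants C ≥ 1 and c ∈ (0,1) such that for each CZ cube Q there is a sequence S(Q) of CZ cubes Q = Q^1, Q^2, … satisfying: consecutive cubes are neighbors (Q^k ↔ Q^{k+1}); δ_{Q^k} ≤ C·c^{k−ℓ}·δ_{Q^ℓ} for k ≥ ℓ; and either the sequence is finite ending at a keystone cube, or it is infinite and the centers x^k = ctr(Q^k) converge to a point x' ∈ K_p. -/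
open MeasureTheory
open scoped ENNReal

noncomputable section

namespace DyadicCube

variable {n : ℕ}

lemma pow_pos' (k : ℤ) : (0:ℝ) < 2 ^ k := zpow_pos (by norm_num) k

lemma toSet_eq_pi (A : DyadicCube n) : A.toSet =
    Set.pi Set.univ (fun i => Set.Ioc ((A.j i : ℝ) * 2 ^ A.k) (((A.j i : ℝ) + 1) * 2 ^ A.k)) := by
  ext x; simp [toSet, Set.mem_pi]

lemma closure_toSet (A : DyadicCube n) : closure A.toSet =
    {x | ∀ i, (A.j i : ℝ) * 2 ^ A.k ≤ x i ∧ x i ≤ ((A.j i : ℝ) + 1) * 2 ^ A.k} := by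
  rw [toSet_eq_pi, closure_pi_set]
  ext x
  simp only [Set.mem_pi, Set.mem_univ, true_implies, Set.mem_ofPred_eq]
  refine forall_congr' fun i => ?_
  rw [closure_Ioc, Set.mem_Icc]
  have := pow_pos' A.k
  intro h
  nlinarith

lemma sub_iff (A B : DyadicCube n) : A.toSet ⊆ B.toSet ↔
    ∀ i, (B.j i : ℝ) * 2 ^ B.k ≤ A.j i * 2 ^ A.k ∧
      ((A.j i : ℝ) + 1) * 2 ^ A.k ≤ (B.j i + 1) * 2 ^ B.k := by
  constructor
  · intro h i
    have h2 := closure_mono h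
    rw [closure_toSet, closure_toSet] at h2
    have hp := pow_pos' A.k
    have h3 := h2 (a := fun i => (A.j i : ℝ) * 2 ^ A.k) (fun i => ⟨le_rfl, by nlinarith⟩) i
    have h4 := h2 (a := fun i => ((A.j i : ℝ) + 1) * 2 ^ A.k) (fun i => ⟨by nlinarith, le_rfl⟩) i
    exact ⟨h3.1, h4.2⟩
  · intro h x hx i
    exact ⟨(h i).1.trans_lt (hx i).1, (hx i).2.trans (h i).2⟩

lemma unit_iff (A : DyadicCube n) : A.toSet ⊆ (unitCube n).toSet ↔
    ∀ i, 0 ≤ (A.j i : ℝ) * 2 ^ A.k ∧ ((A.j i : ℝ) + 1) * 2 ^ A.k ≤ 1 := by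
  rw [sub_iff]; simp [unitCube]

lemma scale_le (hn : 1 ≤ n) {A B : DyadicCube n} (h : A.toSet ⊆ B.toSet) : A.k ≤ B.k := by
  rw [sub_iff] at h
  have := h ⟨0, hn⟩
  have h2 : (2:ℝ) ^ A.k ≤ 2 ^ B.k := by linarith
  exact (zpow_le_zpow_iff_right₀ (by norm_num)).1 h2

lemma scale_lt (hn : 1 ≤ n) {A B : DyadicCube n} (h : A.toSet ⊂ B.toSet) : A.k < B.k := by
  refine lt_of_le_of_ne (scale_le hn h.1) ?_
  intro hk
  apply h.2
  have h1 := h.1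
  rw [sub_iff] at h1 ⊢
  have hp := pow_pos' A.k
  rw [← hk] at h1 ⊢
  intro i
  have := h1 i
  constructor <;> linarith

lemma mem_dilate3 (A : DyadicCube n) (x : Fin n → ℝ) : x ∈ A.dilate 3 ↔
    ∀ i, ((A.j i : ℝ) - 1) * 2 ^ A.k ≤ x i ∧ x i ≤ ((A.j i : ℝ) + 2) * 2 ^ A.k := by
  simp only [dilate, Set.mem_ofPred_eq, center, sidelength, abs_le]
  refine forall_congr' fun i => ?_
  constructor <;> rintro ⟨h1, h2⟩ <;> constructor <;> linarith

lemma dilate3_sub {A B : DyadicCube n}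
    (h : ∀ i, ((B.j i : ℝ) - 1) * 2 ^ B.k ≤ (A.j i - 1) * 2 ^ A.k ∧
      ((A.j i : ℝ) + 2) * 2 ^ A.k ≤ (B.j i + 2) * 2 ^ B.k) : A.dilate 3 ⊆ B.dilate 3 := by
  intro x hx
  rw [mem_dilate3] at hx ⊢
  intro i
  exact ⟨(h i).1.trans (hx i).1, (hx i).2.trans (h i).2⟩

lemma dilate3_mono {A B : DyadicCube n} (h : A.toSet ⊆ B.toSet) : A.dilate 3 ⊆ B.dilate 3 := by
  rw [sub_iff] at h
  refine dilate3_sub fun i => ?_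
  have := h i
  constructor <;> linarith

/-- The dyadic parent. -/
def parent (A : DyadicCube n) : DyadicCube n := ⟨A.k + 1, fun i => A.j i / 2⟩

lemma sub_parent (A : DyadicCube n) : A.toSet ⊆ A.parent.toSet := by
  rw [sub_iff]
  intro i
  have hp := pow_pos' A.k
  have e : (2:ℝ) ^ (A.k + 1) = 2 ^ A.k * 2 := zpow_add_one₀ (by norm_num) _
  have h1 : 2 * (A.j i / 2) ≤ A.j i := by omega
  have h2 : A.j i + 1 ≤ 2 * (A.j i / 2 + 1) := by omega
  have h1' : 2 * ((A.j i / 2 : ℤ) : ℝ) ≤ A.j i := by exact_mod_cast h1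
  have h2' : (A.j i : ℝ) + 1 ≤ 2 * (((A.j i / 2 : ℤ) : ℝ) + 1) := by exact_mod_cast h2
  simp only [parent, e]
  constructor <;> nlinarith

lemma parent_sub {A B : DyadicCube n} (h : A.toSet ⊆ B.toSet) (hk : A.k < B.k) :
    A.parent.toSet ⊆ B.toSet := by
  rw [sub_iff] at h ⊢
  intro i
  obtain ⟨h1, h2⟩ := h i
  have hp := pow_pos' A.k
  obtain ⟨d, hd⟩ : ∃ d : ℕ, B.k = A.k + 1 + d := ⟨(B.k - A.k - 1).toNat, by omega⟩
  have e : (2:ℝ) ^ (A.k + 1) = 2 ^ A.k * 2 := zpow_add_one₀ (by norm_num) _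
  have e2 : (2:ℝ) ^ B.k = 2 ^ A.k * 2 * 2 ^ d := by
    rw [hd, zpow_add₀ (by norm_num), e, zpow_natCast]
  simp only [parent, e]
  rw [e2] at h1 h2 ⊢
  have h1' : (2:ℝ) * (B.j i * 2 ^ d) ≤ A.j i := by
    refine le_of_mul_le_mul_right ?_ hp
    linarith
  have h2' : (A.j i : ℝ) + 1 ≤ 2 * ((B.j i + 1) * 2 ^ d) := by
    refine le_of_mul_le_mul_right ?_ hp
    linarith
  have h1z : 2 * (B.j i * 2 ^ d) ≤ A.j i := by exact_mod_cast h1'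
  have h2z : A.j i + 1 ≤ 2 * ((B.j i + 1) * 2 ^ d) := by exact_mod_cast h2'
  have h3 : B.j i * 2 ^ d ≤ A.j i / 2 := by omega
  have h4 : A.j i / 2 + 1 ≤ (B.j i + 1) * 2 ^ d := by omega
  have h3' : (B.j i : ℝ) * 2 ^ d ≤ ((A.j i / 2 : ℤ) : ℝ) := by exact_mod_cast h3
  have h4' : ((A.j i / 2 : ℤ) : ℝ) + 1 ≤ ((B.j i : ℝ) + 1) * 2 ^ d := by exact_mod_cast h4
  constructor <;> nlinarith

lemma exists_anc {A : DyadicCube n} (h : A.toSet ⊆ (unitCube n).toSet) (k : ℤ) (hk : A.k ≤ k)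
    (hk0 : k ≤ 0) : ∃ R : DyadicCube n, R.k = k ∧ A.toSet ⊆ R.toSet ∧
      R.toSet ⊆ (unitCube n).toSet := by
  induction k, hk using Int.leInduction with
  | base => exact ⟨A, rfl, le_rfl, h⟩
  | succ k hk ih =>
    obtain ⟨R, h1, h2, h3⟩ := ih (by omega)
    exact ⟨R.parent, by simp [parent, h1], h2.trans R.sub_parent,
      parent_sub h3 (by simp only [unitCube]; omega)⟩

end DyadicCube

open DyadicCube

lemma exists_CZ {n : ℕ} (hn : 1 ≤ n) (OK : DyadicCube n → Prop) : ∀ (d : ℕ) (R : DyadicCube n),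
    R.toSet ⊆ (unitCube n).toSet → OK R → -R.k ≤ d →
    ∃ P, CZ OK P ∧ R.toSet ⊆ P.toSet := by
  intro d
  induction d with
  | zero =>
    intro R hR hOK hd
    refine ⟨R, ⟨hR, hOK, fun Q' h1 h2 => ?_⟩, le_rfl⟩
    have := scale_lt hn h2
    have := scale_le hn h1
    simp only [unitCube] at this
    omega
  | succ d ih =>
    intro R hR hOK hd
    by_cases h : CZ OK R
    · exact ⟨R, h, le_rfl⟩
    · simp only [CZ, not_and, not_forall, not_not] at h
      obtain ⟨Q', h1, h2, h3⟩ := h hR hOK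
      have := scale_lt hn h2
      obtain ⟨P, hP, hP2⟩ := ih Q' h1 h3 (by push_cast at hd; omega)
      exact ⟨P, hP, h2.1.trans hP2⟩

/-- A CZ cube has no OK parent inside the unit cube. -/
lemma CZ_parent {n : ℕ} (hn : 1 ≤ n) {OK : DyadicCube n → Prop} {Q : DyadicCube n}
    (h : CZ OK Q) (hk : Q.k < 0) : Q.parent.toSet ⊆ (unitCube n).toSet ∧ ¬ OK Q.parent := by
  have h1 : Q.parent.toSet ⊆ (unitCube n).toSet := parent_sub h.1 (by simpa [unitCube] using hk)
  refine ⟨h1, h.2.2 _ h1 ⟨Q.sub_parent, fun h2 => ?_⟩⟩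
  have := scale_le hn h2
  simp [parent] at this

lemma exists_block {n : ℕ} (hn : 1 ≤ n) {OK : DyadicCube n → Prop} (hmono : OKmono OK)
    (Q : DyadicCube n) (hQ : CZ OK Q) :
    ∃ B : ℕ → DyadicCube n, B 0 = Q ∧ (∀ s, CZ OK (B s)) ∧
      (∀ s, (closure (B s).toSet ∩ closure (B (s + 1)).toSet).Nonempty) ∧
      (∀ s, Q.sidelength / 2 ≤ (B s).sidelength ∧ (B s).sidelength ≤ 64 * Q.sidelength) ∧
      (¬ Keystone OK Q → (B 50).sidelength = Q.sidelength / 2) := by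
  have hpos : 0 < Q.sidelength := pow_pos' _
  have hself : ∀ A : DyadicCube n, (closure A.toSet ∩ closure A.toSet).Nonempty := by
    intro A
    rw [Set.inter_self, closure_toSet]
    have := pow_pos' A.k
    exact ⟨fun i => (A.j i : ℝ) * 2 ^ A.k, fun i => ⟨le_rfl, by nlinarith⟩⟩
  by_cases hK : Keystone OK Q
  · exact ⟨fun _ => Q, rfl, fun _ => hQ, fun _ => hself Q,
      fun _ => ⟨by linarith, by linarith⟩, fun h => absurd hK h⟩
  have hK' := hK
  simp only [Keystone, not_and, not_forall, not_le] at hK'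
  obtain ⟨Q', hQ', ⟨y, hy, hy2⟩, hlt⟩ := hK' hQ
  have hk : Q'.k < Q.k := by
    simpa [sidelength] using (zpow_lt_zpow_iff_right₀ (a := (2:ℝ)) (by norm_num)).1 hlt
  have hQ0 : Q.k ≤ 0 := scale_le hn hQ.1
  have hp := pow_pos' Q.k
  obtain ⟨R', hR'k, hR'sub, hR'u⟩ := exists_anc hQ'.1 Q.k hk.le hQ0
  have hR'OK : ¬ OK R' := by
    refine hQ'.2.2 R' hR'u ⟨hR'sub, fun h => ?_⟩
    have := scale_le hn h
    omega
  have hyR := hR'sub hy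
  have hj : ∀ i, R'.j i ≤ Q.j i + 50 ∧ Q.j i ≤ R'.j i + 50 := by
    intro i
    have h1 := hyR i
    have h2 := abs_le.1 (hy2 i)
    simp only [center, sidelength] at h2
    rw [hR'k] at h1
    have h3 : (R'.j i : ℝ) < Q.j i + 50 + 1 := lt_of_mul_lt_mul_right (a := (2:ℝ) ^ Q.k)
      (by linarith) hp.le
    have h4 : (Q.j i : ℝ) < R'.j i + 50 + 1 := lt_of_mul_lt_mul_right (a := (2:ℝ) ^ Q.k)
      (by linarith) hp.le
    have h3' : R'.j i < Q.j i + 50 + 1 := by exact_mod_cast h3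
    have h4' : Q.j i < R'.j i + 50 + 1 := by exact_mod_cast h4
    omega
  -- the path of grid cubes
  let R : ℕ → DyadicCube n := fun s =>
    ⟨Q.k, fun i => max (Q.j i - s) (min (Q.j i + s) (R'.j i))⟩
  have hRk : ∀ s, (R s).k = Q.k := fun s => rfl
  have hRj : ∀ s i, (R s).j i = max (Q.j i - s) (min (Q.j i + s) (R'.j i)) := fun s i => rfl
  have hR0 : R 0 = Q := by
    have : (R 0).j = Q.j := by
      funext i
      rw [hRj]
      push_cast
      omega
    cases Q
    simp only [R] at this ⊢
    congr
  have hR50 : R 50 = R' := by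
    have : (R 50).j = R'.j := by
      funext i
      have := hj i
      rw [hRj]
      push_cast
      omega
    cases R'
    simp only [R] at this hR'k ⊢
    subst hR'k
    congr
  have hRu : ∀ s, (R s).toSet ⊆ (unitCube n).toSet := by
    intro s
    rw [unit_iff]
    intro i
    have h1 := (unit_iff _).1 hQ.1 i
    have h2 := (unit_iff _).1 hR'u i
    rw [hR'k] at h2
    rw [hRk]
    have h3 : (R s).j i ≤ max (Q.j i) (R'.j i) := by rw [hRj]; omega
    have h4 : min (Q.j i) (R'.j i) ≤ (R s).j i := by rw [hRj]; omega
    constructor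
    · rcases min_le_iff.1 h4 with h | h
      · have : (Q.j i : ℝ) ≤ (R s).j i := by exact_mod_cast h
        nlinarith
      · have : (R'.j i : ℝ) ≤ (R s).j i := by exact_mod_cast h
        nlinarith
    · rcases le_max_iff.1 h3 with h | h
      · have : ((R s).j i : ℝ) ≤ Q.j i := by exact_mod_cast h
        nlinarith
      · have : ((R s).j i : ℝ) ≤ R'.j i := by exact_mod_cast h
        nlinarith
  classical
  have hex : ∃ s, ¬ OK (R s) := ⟨50, by rwa [hR50]⟩
  obtain ⟨t, ht, htmin⟩ : ∃ t, ¬ OK (R t) ∧ ∀ s < t, OK (R s) :=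
    ⟨Nat.find hex, Nat.find_spec hex, fun s hs => not_not.1 (Nat.find_min hex hs)⟩
  have ht50 : t ≤ 50 := by
    by_contra h
    exact (by rwa [hR50] : ¬ OK (R 50)) (htmin 50 (by omega))
  have ht0 : t ≠ 0 := by
    rintro rfl
    rw [hR0] at ht
    exact ht hQ.2.1
  obtain ⟨u, rfl⟩ : ∃ u, t = u + 1 := ⟨t - 1, by omega⟩
  have hPex : ∀ s, ∃ P, s < u + 1 → (CZ OK P ∧ (R s).toSet ⊆ P.toSet ∧ (s = 0 → P = Q)) := by
    intro s
    by_cases hs : s < u + 1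
    · by_cases h0 : s = 0
      · subst h0
        exact ⟨Q, fun _ => ⟨hQ, by rw [hR0], fun _ => rfl⟩⟩
      · obtain ⟨P, h1, h2⟩ := exists_CZ hn OK (-(R s).k).toNat (R s) (hRu s) (htmin s hs) (by omega)
        exact ⟨P, fun _ => ⟨h1, h2, fun h => absurd h h0⟩⟩
    · exact ⟨Q, fun h => absurd h hs⟩
  choose P hP using hPex
  have hstep : ∀ s i, (R (s+1)).j i ≤ (R s).j i + 1 ∧ (R s).j i ≤ (R (s+1)).j i + 1 := by
    intro s i
    rw [hRj, hRj]
    push_cast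
    omega
  -- the final small cube
  let T : DyadicCube n := ⟨Q.k - 1, fun i =>
    if (R u).j i ≤ (R (u+1)).j i then 2 * (R (u+1)).j i else 2 * (R (u+1)).j i + 1⟩
  have hTk : T.k = Q.k - 1 := rfl
  have hTj : ∀ i, T.j i =
    if (R u).j i ≤ (R (u+1)).j i then 2 * (R (u+1)).j i else 2 * (R (u+1)).j i + 1 := fun i => rfl
  have e : (2:ℝ) ^ Q.k = 2 * 2 ^ (Q.k - 1) := by
    rw [zpow_sub_one₀ (by norm_num)]; ring
  have hq := pow_pos' (Q.k - 1)
  have hTpar : T.parent = R (u+1) := by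
    have h1 : T.parent.k = (R (u+1)).k := by simp [parent, hTk, hRk]
    have h2 : T.parent.j = (R (u+1)).j := by
      funext i
      simp only [parent, hTj]
      split_ifs <;> omega
    cases h : R (u+1)
    rw [h] at h1 h2
    simp only [parent] at h1 h2 ⊢
    congr
  have hTu : T.toSet ⊆ (unitCube n).toSet := by
    refine T.sub_parent.trans ?_
    rw [hTpar]
    exact hRu _
  have hTOK : OK T := by
    refine hmono T (R u) hTu (hRu u) (htmin u (by omega)) (dilate3_sub fun i => ?_)
    rw [hTk, hRk, e]
    have h1 : 2 * ((R u).j i - 1) ≤ T.j i - 1 := by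
      have := hstep u i
      rw [hTj]
      split_ifs <;> omega
    have h2 : T.j i + 2 ≤ 2 * ((R u).j i + 2) := by
      have := hstep u i
      rw [hTj]
      split_ifs <;> omega
    have h1' : 2 * (((R u).j i : ℝ) - 1) ≤ T.j i - 1 := by exact_mod_cast h1
    have h2' : (T.j i : ℝ) + 2 ≤ 2 * ((R u).j i + 2) := by exact_mod_cast h2
    constructor <;> nlinarith
  have hTCZ : CZ OK T := by
    refine ⟨hTu, hTOK, fun A hA hA2 hAOK => ht ?_⟩
    have h1 : T.parent.toSet ⊆ A.toSet := parent_sub hA2.1 (scale_lt hn hA2)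
    rw [hTpar] at h1
    exact hmono _ A (hRu _) hA hAOK (dilate3_mono h1)
  have hTs : T.sidelength = Q.sidelength / 2 := by
    simp only [sidelength, hTk]
    rw [e]; ring
  refine ⟨fun s => if s < u + 1 then P s else T, ?_, ?_, ?_, ?_, ?_⟩
  · simp only [Nat.zero_lt_succ, if_true]
    exact (hP 0 (by omega)).2.2 rfl
  · intro s
    dsimp only
    split_ifs with h
    · exact (hP s h).1
    · exact hTCZ
  · intro s
    dsimp only
    have hmeet : ∀ i, ((R s).j i : ℝ) ≤ max ((R s).j i : ℝ) ((R (s+1)).j i : ℝ) ∧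
        ((R (s+1)).j i : ℝ) ≤ max ((R s).j i : ℝ) ((R (s+1)).j i : ℝ) ∧
        max ((R s).j i : ℝ) ((R (s+1)).j i : ℝ) ≤ (R s).j i + 1 ∧
        max ((R s).j i : ℝ) ((R (s+1)).j i : ℝ) ≤ (R (s+1)).j i + 1 := by
      intro i
      have := hstep s i
      refine ⟨le_max_left _ _, le_max_right _ _, max_le (by linarith) ?_, max_le ?_ (by linarith)⟩
      · exact_mod_cast this.1
      · exact_mod_cast this.2
    let z : Fin n → ℝ := fun i => (max ((R s).j i : ℝ) ((R (s+1)).j i)) * 2 ^ Q.k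
    have hz1 : z ∈ closure (R s).toSet := by
      rw [closure_toSet]
      intro i
      have := hmeet i
      rw [hRk]
      exact ⟨mul_le_mul_of_nonneg_right this.1 hp.le, mul_le_mul_of_nonneg_right this.2.2.1 hp.le⟩
    rcases lt_trichotomy s u with h | h | h
    · rw [if_pos (by omega), if_pos (by omega)]
      have hz2 : z ∈ closure (R (s+1)).toSet := by
        rw [closure_toSet]
        intro i
        have := hmeet i
        rw [hRk]
        exact ⟨mul_le_mul_of_nonneg_right this.2.1 hp.le,
          mul_le_mul_of_nonneg_right this.2.2.2 hp.le⟩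
      exact ⟨z, closure_mono (hP s (by omega)).2.1 hz1, closure_mono (hP (s+1) (by omega)).2.1 hz2⟩
    · subst h
      rw [if_pos (by omega), if_neg (by omega)]
      refine ⟨z, closure_mono (hP s (by omega)).2.1 hz1, ?_⟩
      rw [closure_toSet]
      intro i
      have hs := hstep s i
      have h1 : T.j i ≤ 2 * max ((R s).j i) ((R (s+1)).j i) := by
        rw [hTj]; split_ifs <;> omega
      have h2 : 2 * max ((R s).j i) ((R (s+1)).j i) ≤ T.j i + 1 := by
        rw [hTj]; split_ifs <;> omega
      have h1' : (T.j i : ℝ) ≤ 2 * max ((R s).j i : ℝ) ((R (s+1)).j i) := by exact_mod_cast h1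
      have h2' : 2 * max ((R s).j i : ℝ) ((R (s+1)).j i) ≤ (T.j i : ℝ) + 1 := by exact_mod_cast h2
      simp only [z]
      rw [hTk, e]
      constructor <;> nlinarith
    · rw [if_neg (by omega), if_neg (by omega)]
      exact hself T
  · intro s
    dsimp only
    split_ifs with h
    · obtain ⟨h1, h2, -⟩ := hP s h
      have hle : Q.k ≤ (P s).k := scale_le (A := R s) hn h2
      have hle' : Q.sidelength ≤ (P s).sidelength :=
        zpow_le_zpow_right₀ (by norm_num) hle
      refine ⟨by linarith, ?_⟩
      by_contra hcon
      push Not at hcon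
      apply ht
      refine hmono _ (P s) (hRu _) h1.1 h1.2.1 (dilate3_sub fun i => ?_)
      have h3 := (sub_iff _ _).1 h2 i
      simp only [sidelength] at hcon
      rw [hRk] at h3 ⊢
      have h4 : (R s).j i ≤ (R (u+1)).j i + 50 ∧ (R (u+1)).j i ≤ (R s).j i + 50 := by
        rw [hRj, hRj]
        push_cast
        have := hj i
        omega
      have h5 : ((R s).j i : ℝ) ≤ (R (u+1)).j i + 50 := by exact_mod_cast h4.1
      have h6 : ((R (u+1)).j i : ℝ) ≤ (R s).j i + 50 := by exact_mod_cast h4.2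
      have h5' := mul_le_mul_of_nonneg_right h5 hp.le
      have h6' := mul_le_mul_of_nonneg_right h6 hp.le
      constructor <;> linarith
    · rw [hTs]
      exact ⟨le_rfl, by linarith⟩
  · intro _
    dsimp only
    rw [if_neg (by omega)]
    exact hTs

lemma parent_near {n : ℕ} (A : DyadicCube n) {y : Fin n → ℝ} (hy : y ∈ A.parent.dilate 3)
    (i : Fin n) : |y i - A.center i| ≤ 4 * A.sidelength := by
  have h := (mem_dilate3 _ _).1 hy i
  have hp := pow_pos' A.k
  have e : (2:ℝ) ^ (A.k + 1) = 2 ^ A.k * 2 := zpow_add_one₀ (by norm_num) _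
  simp only [parent, e] at h
  have h1 : A.j i ≤ 2 * (A.j i / 2) + 1 := by omega
  have h2 : 2 * (A.j i / 2) ≤ A.j i := by omega
  have h1' : (A.j i : ℝ) ≤ 2 * ((A.j i / 2 : ℤ) : ℝ) + 1 := by exact_mod_cast h1
  have h2' : 2 * ((A.j i / 2 : ℤ) : ℝ) ≤ A.j i := by exact_mod_cast h2
  simp only [center, sidelength]
  rw [abs_le]
  constructor <;> nlinarith

lemma center_dist {n : ℕ} (A B : DyadicCube n)
    (h : (closure A.toSet ∩ closure B.toSet).Nonempty) :
    dist A.center B.center ≤ (A.sidelength + B.sidelength) / 2 := by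
  obtain ⟨z, h1, h2⟩ := h
  rw [closure_toSet] at h1 h2
  have hA := pow_pos' A.k
  have hB := pow_pos' B.k
  refine (dist_pi_le_iff (by simp only [sidelength]; positivity)).2 fun i => ?_
  have h3 := h1 i
  have h4 := h2 i
  rw [Real.dist_eq, abs_le]
  simp only [center, sidelength]
  constructor <;> linarith

lemma limit_mem {n : ℕ} (hn : 1 ≤ n) {OK : DyadicCube n → Prop} (hmono : OKmono OK)
    (μ : Measure (Fin n → ℝ)) (hμ : μ (((unitCube n).dilate (1 / 10))ᶜ) = 0)
    (hOK : ∀ Q : DyadicCube n, Q.toSet ⊆ (unitCube n).toSet → μ (Q.dilate 3) = 0 → OK Q)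
    (S : ℕ → DyadicCube n) (hS : ∀ k, CZ OK (S k)) (x : Fin n → ℝ)
    (hx : Filter.Tendsto (fun k => (S k).center) Filter.atTop (nhds x))
    (hδ : Filter.Tendsto (fun k => (S k).sidelength) Filter.atTop (nhds 0)) : x ∈ Kp OK := by
  have key : ∀ ε : ℝ, 0 < ε → ε ≤ 1 → ∃ P : DyadicCube n, P.toSet ⊆ (unitCube n).toSet ∧ ¬ OK P ∧
      ∀ y ∈ P.dilate 3, ∀ i, |y i - x i| ≤ 5 * ε := by
    intro ε hε hε1
    have h1 := Metric.tendsto_nhds.1 hx ε hε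
    have h2 := hδ.eventually_lt_const hε
    obtain ⟨k, h3, h4⟩ := (h1.and h2).exists
    have hk : (S k).k < 0 := by
      have : (2:ℝ) ^ (S k).k < 2 ^ (0:ℤ) := by
        rw [zpow_zero]; exact h4.trans_le hε1
      exact (zpow_lt_zpow_iff_right₀ (by norm_num)).1 this
    obtain ⟨h5, h6⟩ := CZ_parent hn (hS k) hk
    refine ⟨_, h5, h6, fun y hy i => ?_⟩
    have h7 := parent_near _ hy i
    have h8 := (dist_le_pi_dist _ _ i).trans h3.le
    rw [Real.dist_eq] at h8
    have := abs_sub_le (y i) ((S k).center i) (x i)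
    linarith
  refine ⟨fun i => ?_, ?_⟩
  · simp only [unitCube, Int.cast_zero, zpow_zero, zero_add, mul_one]
    constructor
    · by_contra hcon
      push Not at hcon
      obtain ⟨P, h1, h2, h3⟩ := key (1 / 16) (by norm_num) (by norm_num)
      apply h2
      apply hOK P h1
      refine measure_mono_null ?_ hμ
      intro y hy hy2
      have h4 := abs_le.1 (h3 y hy i)
      have h5 := abs_le.1 (hy2 i)
      simp only [unitCube, center, sidelength, Int.cast_zero, zpow_zero] at h5
      linarith
    · have h1 := (tendsto_pi_nhds.1 hx) i
      refine le_of_tendsto' h1 fun k => ?_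
      have h2 := (unit_iff _).1 (hS k).1 i
      have := pow_pos' (S k).k
      simp only [center]
      linarith
  · intro hcon
    simp only [KCZ, Set.mem_iUnion] at hcon
    obtain ⟨A, hA, hxA⟩ := hcon
    have hp := pow_pos' A.k
    have hk : (2:ℝ) ^ A.k ≤ 1 := by
      have : A.k ≤ 0 := scale_le hn hA.1
      exact zpow_le_one_of_nonpos₀ (by norm_num) this
    obtain ⟨P, h1, h2, h3⟩ := key ((2:ℝ) ^ A.k / 8) (by linarith) (by linarith)
    apply h2
    refine hmono P A h1 hA.1 hA.2.1 fun y hy => ?_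
    rw [mem_dilate3]
    intro i
    have h4 := abs_le.1 (h3 y hy i)
    have h5 := hxA i
    constructor <;> linarith

/-- **Chains of CZ cubes leading to keystone cubes or keystone points (Lemma `ageolm`).**
There are universal constants `C ≥ 1` and `c ∈ (0,1)` such that, under the standing
assumptions on `OK` and `μ`, for each CZ cube `Q` there is a sequence `S(Q)` of CZ cubes
starting at `Q` in which consecutive cubes are neighbors and
`δ_{Q^k} ≤ C c^{k−ℓ} δ_{Q^ℓ}` for `k ≥ ℓ`, and which either is finite ending at a keystone
cube, or is infinite with centers converging to a point `x' ∈ K_p`. -/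
theorem stmt15 (n m : ℕ) (hn : 1 ≤ n) (hm : 1 ≤ m) (p : ℝ) (hp : (n : ℝ) < p) :
    ∃ C c : ℝ, 1 ≤ C ∧ 0 < c ∧ c < 1 ∧
      ∀ ε₀ C₀ : ℝ, 0 < ε₀ → 0 < C₀ →
      ∀ (μ : Measure (Fin n → ℝ)) (OK : DyadicCube n → Prop),
        OKmono OK →
        μ (((unitCube n).dilate (1 / 10))ᶜ) = 0 →
        (∀ Q : DyadicCube n, Q.toSet ⊆ (unitCube n).toSet →
          μ (Q.dilate 3) ≤
            ENNReal.ofReal ((ε₀ / C₀) ^ p * (30 * Q.sidelength) ^ ((n : ℝ) - (m : ℝ) * p)) →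
          OK Q) →
      ∀ Q : DyadicCube n, CZ OK Q →
        ∃ S : ℕ → DyadicCube n, S 0 = Q ∧
          ((∃ L : ℕ, 1 ≤ L ∧ (∀ k < L, CZ OK (S k)) ∧
              (∀ k : ℕ, k + 1 < L →
                (closure (S k).toSet ∩ closure (S (k + 1)).toSet).Nonempty) ∧
              (∀ ℓ k : ℕ, ℓ ≤ k → k < L →
                (S k).sidelength ≤ C * c ^ (k - ℓ) * (S ℓ).sidelength) ∧
              Keystone OK (S (L - 1))) ∨
           ((∀ k : ℕ, CZ OK (S k)) ∧
              (∀ k : ℕ, (closure (S k).toSet ∩ closure (S (k + 1)).toSet).Nonempty) ∧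
              (∀ ℓ k : ℕ, ℓ ≤ k → (S k).sidelength ≤ C * c ^ (k - ℓ) * (S ℓ).sidelength) ∧
              (∃ x' ∈ Kp OK, Filter.Tendsto (fun k => (S k).center)
                Filter.atTop (nhds x')))) := by
  have hc0 : (0:ℝ) < (1/2 : ℝ) ^ ((1:ℝ)/50) := by positivity
  have hc1 : (1/2 : ℝ) ^ ((1:ℝ)/50) < 1 := Real.rpow_lt_one (by norm_num) (by norm_num) (by norm_num)
  have hc50 : ((1/2 : ℝ) ^ ((1:ℝ)/50)) ^ 50 = 1 / 2 := by
    rw [← Real.rpow_natCast, ← Real.rpow_mul (by norm_num)]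
    norm_num
  generalize (1/2 : ℝ) ^ ((1:ℝ)/50) = c at hc0 hc1 hc50
  refine ⟨256, c, by norm_num, hc0, hc1, ?_⟩
  intro ε₀ C₀ hε hC μ OK hmono hμ hOK Q hQ
  have hOK' : ∀ Q : DyadicCube n, Q.toSet ⊆ (unitCube n).toSet → μ (Q.dilate 3) = 0 → OK Q :=
    fun A h1 h2 => hOK A h1 (by rw [h2]; exact bot_le)
  have hB : ∀ q : {q : DyadicCube n // CZ OK q}, _ := fun q => exists_block hn hmono q.1 q.2
  choose B hB0 hBCZ hBmeet hBsize hBlast using hB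
  let N : {q : DyadicCube n // CZ OK q} → {q : DyadicCube n // CZ OK q} := fun q =>
    ⟨B q 50, hBCZ q 50⟩
  let q : ℕ → {q : DyadicCube n // CZ OK q} := fun i => N^[i] ⟨Q, hQ⟩
  have hq0 : (q 0).1 = Q := rfl
  have hqs : ∀ i, (q (i + 1)).1 = B (q i) 50 := fun i => by
    simp only [q, Function.iterate_succ_apply']
    rfl
  let S : ℕ → DyadicCube n := fun k => B (q (k / 50)) (k % 50)
  have hS0 : S 0 = Q := hB0 _
  have hSq : ∀ i, S (50 * i) = (q i).1 := by
    intro i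
    simp only [S, Nat.mul_mod_right]
    rw [Nat.mul_div_cancel_left _ (by norm_num)]
    exact hB0 _
  have hSCZ : ∀ k, CZ OK (S k) := fun k => hBCZ _ _
  have hSs : ∀ k, S (k + 1) = B (q (k / 50)) (k % 50 + 1) := by
    intro k
    by_cases h : k % 50 = 49
    · have : k + 1 = 50 * (k / 50 + 1) := by omega
      rw [h, this, hSq, hqs]
    · have h1 : (k + 1) / 50 = k / 50 := by omega
      have h2 : (k + 1) % 50 = k % 50 + 1 := by omega
      simp only [S, h1, h2]
  have hSmeet : ∀ k, (closure (S k).toSet ∩ closure (S (k + 1)).toSet).Nonempty := by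
    intro k
    rw [hSs]
    exact hBmeet _ _
  have hQpos : 0 < Q.sidelength := pow_pos' _
  have hqsize : ∀ M, (∀ i < M, ¬ Keystone OK (q i).1) →
      ∀ i ≤ M, (q i).1.sidelength = (1 / 2) ^ i * Q.sidelength := by
    intro M hM i
    induction i with
    | zero => intro _; rw [hq0]; simp
    | succ i ih =>
      intro hi
      rw [hqs, hBlast _ (hM i (by omega)), ih (by omega), pow_succ]
      ring
  have hdecay : ∀ M, (∀ i < M, ¬ Keystone OK (q i).1) → ∀ ℓ k : ℕ, ℓ ≤ k → k ≤ 50 * M →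
      (S k).sidelength ≤ 256 * c ^ (k - ℓ) * (S ℓ).sidelength := by
    intro M hM ℓ k hℓ hk
    have hk1 := (hBsize (q (k / 50)) (k % 50)).2
    have hl1 := (hBsize (q (ℓ / 50)) (ℓ % 50)).1
    rw [hqsize M hM _ (by omega)] at hk1 hl1
    change (S k).sidelength ≤ _ at hk1
    change _ ≤ (S ℓ).sidelength at hl1
    rw [← hc50, ← pow_mul] at hk1 hl1
    have h1 : c ^ ℓ ≤ c ^ (50 * (ℓ / 50)) := pow_le_pow_of_le_one hc0.le hc1.le (by omega)
    have h2 : c ^ (50 * (k / 50)) * c ^ 50 ≤ c ^ k := by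
      rw [← pow_add]
      exact pow_le_pow_of_le_one hc0.le hc1.le (by omega)
    have h3 : c ^ (k - ℓ) * c ^ ℓ = c ^ k := by rw [← pow_add]; congr 1; omega
    rw [hc50] at h2
    have h4 : c ^ ℓ * Q.sidelength / 2 ≤ (S ℓ).sidelength := by
      have := mul_le_mul_of_nonneg_right h1 hQpos.le
      linarith
    have h5 : (S k).sidelength ≤ 128 * c ^ k * Q.sidelength := by
      have := mul_le_mul_of_nonneg_right h2 hQpos.le
      linarith
    have h6 : (0:ℝ) < c ^ (k - ℓ) := by positivity
    calc (S k).sidelength ≤ 128 * (c ^ (k - ℓ) * c ^ ℓ) * Q.sidelength := by rw [h3]; exact h5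
      _ = 256 * c ^ (k - ℓ) * (c ^ ℓ * Q.sidelength / 2) := by ring
      _ ≤ _ := mul_le_mul_of_nonneg_left h4 (by positivity)
  refine ⟨S, hS0, ?_⟩
  classical
  by_cases hex : ∃ M, Keystone OK (q M).1
  · left
    obtain ⟨M, hM, hmin⟩ : ∃ M, Keystone OK (q M).1 ∧ ∀ i < M, ¬ Keystone OK (q i).1 :=
      ⟨Nat.find hex, Nat.find_spec hex, fun i hi => Nat.find_min hex hi⟩
    refine ⟨50 * M + 1, by omega, fun k _ => hSCZ k, fun k _ => hSmeet k,
      fun ℓ k hℓ hk => hdecay M hmin ℓ k hℓ (by omega), ?_⟩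
    rw [Nat.add_sub_cancel, hSq]
    exact hM
  · right
    push Not at hex
    have hd : ∀ ℓ k : ℕ, ℓ ≤ k → (S k).sidelength ≤ 256 * c ^ (k - ℓ) * (S ℓ).sidelength :=
      fun ℓ k h => hdecay k (fun i _ => hex i) ℓ k h (by omega)
    refine ⟨hSCZ, hSmeet, hd, ?_⟩
    have hd0 : ∀ k, (S k).sidelength ≤ 256 * Q.sidelength * c ^ k := by
      intro k
      have := hd 0 k (by omega)
      rw [hS0, Nat.sub_zero] at this
      linarith
    have hcau : CauchySeq (fun k => (S k).center) := by
      refine cauchySeq_of_le_geometric c (256 * Q.sidelength) hc1 fun k => ?_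
      refine (center_dist _ _ (hSmeet k)).trans ?_
      have h1 := hd0 k
      have h2 := hd0 (k + 1)
      have h3 : c ^ (k + 1) ≤ c ^ k := pow_le_pow_of_le_one hc0.le hc1.le (by omega)
      have h4 := mul_le_mul_of_nonneg_left h3 (by positivity : 0 ≤ 256 * Q.sidelength)
      linarith
    obtain ⟨x, hx⟩ := cauchySeq_tendsto_of_complete hcau
    refine ⟨x, limit_mem hn hmono μ hμ hOK' S hSCZ x hx ?_, hx⟩
    refine squeeze_zero (fun k => (pow_pos' (S k).k).le) hd0 ?_
    simpa using (tendsto_pow_atTop_nhds_zero_of_lt_one hc0.le hc1).const_mul (256 * Q.sidelength)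

end
end

section
/- Whitney field gluing bound via telescoping and Hölder: Let (P_i)_{i∈I} be a Whitney field over the CZ cubes and (P*_x)_{x∈K_p} a Whitney field on K_p such that the combined field is in C^{m−1,1−n/p}. Define P̄_i to be P_{κ(i)} if κ(i) is a keystone cube index and P*_{κ(i)} if κ(i) ∈ K_p. Then Σ_{i∈I} |P_i − P̄_i|_{x_i, δ_{Q_i}}^p ≤ C · Σ_{j ↔ j'} |P_j − P_{j'}|_{x_j, δ_{Q_j}}^p, where the sum on the right is over pairs of neighboring CZ cubes. -/
open scoped ENNReal

noncomputable section

/-! ### Polynomial facts -/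

theorem wf_coeff_degree_pderiv {n : ℕ} (i : Fin n) (P : MvPolynomial (Fin n) ℝ) (d : ℕ)
    (h : ∀ s : Fin n →₀ ℕ, d + 1 ≤ s.degree → P.coeff s = 0) :
    ∀ s : Fin n →₀ ℕ, d ≤ s.degree → (MvPolynomial.pderiv i P).coeff s = 0 := by
  intro s hs
  rw [MvPolynomial.coeff_pderiv, h, zero_mul]
  rw [map_add, Finsupp.degree_single]
  omega

theorem wf_pderiv_comm {n : ℕ} (i j : Fin n) (P : MvPolynomial (Fin n) ℝ) :
    MvPolynomial.pderiv i (MvPolynomial.pderiv j P) =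
      MvPolynomial.pderiv j (MvPolynomial.pderiv i P) := by
  ext s
  simp only [MvPolynomial.coeff_pderiv]
  by_cases hij : i = j
  · subst hij; rfl
  · have h1 : (Finsupp.single i 1 : Fin n →₀ ℕ) j = 0 := by simp [Ne.symm hij]
    have h2 : (Finsupp.single j 1 : Fin n →₀ ℕ) i = 0 := by simp [hij]
    simp only [Finsupp.add_apply, h1, h2]
    rw [add_right_comm]
    push_cast
    ring

theorem wf_mderivList_perm {n : ℕ} {l l' : List (Fin n)} (h : l.Perm l')
    (P : MvPolynomial (Fin n) ℝ) : mderivList l P = mderivList l' P := by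
  induction h with
  | nil => rfl
  | cons x _ ih => simp only [mderivList, ih]
  | swap x y l => simp only [mderivList]; exact wf_pderiv_comm _ _ _
  | trans _ _ h1 h2 => rw [h1, h2]

theorem wf_mderivList_sub {n : ℕ} (l : List (Fin n)) (P Q : MvPolynomial (Fin n) ℝ) :
    mderivList l (P - Q) = mderivList l P - mderivList l Q := by
  induction l with
  | nil => rfl
  | cons x l ih => simp only [mderivList, ih, map_sub]

theorem wf_mderiv_sub {n : ℕ} (β : Fin n → ℕ) (P Q : MvPolynomial (Fin n) ℝ) :
    mderiv β (P - Q) = mderiv β P - mderiv β Q := wf_mderivList_sub _ _ _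

theorem wf_mderivList_deg {n : ℕ} (l : List (Fin n)) (P : MvPolynomial (Fin n) ℝ) (d : ℕ)
    (h : ∀ s : Fin n →₀ ℕ, d + l.length ≤ s.degree → P.coeff s = 0) :
    ∀ s : Fin n →₀ ℕ, d ≤ s.degree → (mderivList l P).coeff s = 0 := by
  induction l generalizing d with
  | nil => simpa [mderivList] using h
  | cons x l ih =>
    simp only [mderivList]
    apply wf_coeff_degree_pderiv
    apply ih
    intro s hs
    apply h
    simp only [List.length_cons]
    omega

theorem wf_mderivList_zero {n m : ℕ} (hm : 1 ≤ m) (l : List (Fin n))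
    (P : MvPolynomial (Fin n) ℝ) (hP : P.totalDegree ≤ m - 1) (hl : m ≤ l.length) :
    mderivList l P = 0 := by
  ext s
  rw [MvPolynomial.coeff_zero]
  refine wf_mderivList_deg l P 0 ?_ s (Nat.zero_le _)
  intro t ht
  apply MvPolynomial.coeff_eq_zero_of_totalDegree_lt
  rw [← Finsupp.degree_apply]
  omega

def wfList {n : ℕ} (β : Fin n → ℕ) : List (Fin n) :=
  (List.finRange n).flatMap fun i => List.replicate (β i) i

theorem wf_list_length {n : ℕ} (β : Fin n → ℕ) : (wfList β).length = ∑ i, β i := by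
  simp only [wfList, List.length_flatMap, List.length_replicate]
  rw [← List.ofFn_eq_map, List.sum_ofFn]

theorem wf_list_count {n : ℕ} (l : List (Fin n)) : l.Perm (wfList fun i => l.count i) := by
  rw [List.perm_iff_count]
  intro a
  simp only [wfList, List.count_flatMap, Function.comp_def, List.count_replicate]
  rw [← List.ofFn_eq_map, List.sum_ofFn]
  simp

theorem wf_count_mem {n m : ℕ} (hm : 1 ≤ m) (l : List (Fin n)) (hl : l.length < m) :
    (fun i => l.count i) ∈ multiIndices n m ∧ (∑ i, l.count i) = l.length := by
  have h : (∑ i, l.count i) = l.length := by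
    rw [← wf_list_length, ← (wf_list_count l).length_eq]
  refine ⟨?_, h⟩
  simp only [multiIndices, Finset.mem_filter, Fintype.mem_piFinset, Finset.mem_range]
  exact ⟨fun i => lt_of_le_of_lt List.count_le_length hl, by omega⟩

theorem wf_hasDerivAt {n : ℕ} (x v : Fin n → ℝ) (P : MvPolynomial (Fin n) ℝ) (t : ℝ) :
    HasDerivAt (fun t : ℝ => MvPolynomial.eval (x + t • v) P)
      (∑ i, v i * MvPolynomial.eval (x + t • v) (MvPolynomial.pderiv i P)) t := by
  induction P using MvPolynomial.induction_on with
  | C a => simpa using hasDerivAt_const t a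
  | add p q hp hq =>
    simp only [map_add, mul_add, Finset.sum_add_distrib]
    exact hp.add hq
  | mul_X p j hp =>
    have hX : HasDerivAt (fun t : ℝ => x j + t * v j) (v j) t := by
      simpa using ((hasDerivAt_id t).mul_const (v j)).const_add (x j)
    have := hp.mul hX
    simp only [map_mul, MvPolynomial.eval_X, Pi.add_apply, Pi.smul_apply, smul_eq_mul]
    refine this.congr_deriv ?_
    simp only [MvPolynomial.pderiv_mul, map_add, map_mul, MvPolynomial.eval_X, mul_add,
      Finset.sum_add_distrib, Pi.add_apply, Pi.smul_apply, smul_eq_mul, Finset.sum_mul]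
    rw [← Finset.sum_add_distrib, ← Finset.sum_add_distrib, ← Finset.sum_add_distrib]
    have e : ∑ i, v i * (MvPolynomial.eval (x + t • v) p *
        MvPolynomial.eval (x + t • v) (MvPolynomial.pderiv i (MvPolynomial.X j))) =
        MvPolynomial.eval (x + t • v) p * v j := by
      rw [Finset.sum_eq_single j]
      · simp [mul_comm]
      · intro b _ hb
        rw [MvPolynomial.pderiv_X_of_ne (Ne.symm hb)]; simp
      · simp
    rw [← e, ← Finset.sum_add_distrib]
    refine Finset.sum_congr rfl fun i _ => ?_
    ring

theorem wf_mvt {n : ℕ} (x y : Fin n → ℝ) (P : MvPolynomial (Fin n) ℝ) (d B : ℝ)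
    (hd : ‖y - x‖ ≤ d) (hB0 : 0 ≤ B)
    (hB : ∀ z, ‖z - x‖ ≤ d → ∀ i, |MvPolynomial.eval z (MvPolynomial.pderiv i P)| ≤ B) :
    |MvPolynomial.eval y P - MvPolynomial.eval x P| ≤ n * (d * B) := by
  have h := norm_image_sub_le_of_norm_deriv_le_segment_01'
    (f := fun t : ℝ => MvPolynomial.eval (x + t • (y - x)) P) (C := n * (d * B))
    (fun t _ => (wf_hasDerivAt x (y - x) P t).hasDerivWithinAt) ?_
  · simpa using h
  · intro t ht
    refine (norm_sum_le _ _).trans ?_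
    have : ∀ i ∈ (Finset.univ : Finset (Fin n)), ‖(y - x) i * MvPolynomial.eval (x + t • (y - x)) (MvPolynomial.pderiv i P)‖ ≤ d * B := by
      intro i _
      rw [norm_mul]
      have h1 : ‖(y - x) i‖ ≤ d := (norm_le_pi_norm _ i).trans hd
      have h2 := hB (x + t • (y - x)) (by
        rw [add_sub_cancel_left, norm_smul, Real.norm_of_nonneg ht.1]
        have := norm_nonneg (y - x)
        nlinarith [ht.2, ht.1]) i
      rw [← Real.norm_eq_abs] at h2
      exact mul_le_mul h1 h2 (norm_nonneg _) ((norm_nonneg _).trans h1)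
    refine (Finset.sum_le_sum this).trans ?_
    simp

theorem wf_taylor_aux {n m : ℕ} (hm : 1 ≤ m) (R : MvPolynomial (Fin n) ℝ)
    (hR : R.totalDegree ≤ m - 1) (x : Fin n → ℝ) (d T : ℝ) (hd0 : 0 < d) (hT0 : 0 ≤ T)
    (hT : ∀ l : List (Fin n), l.length < m →
      |MvPolynomial.eval x (mderivList l R)| * d ^ l.length ≤ T) (s : ℕ) :
    ∀ l : List (Fin n), m ≤ l.length + s → ∀ y, ‖y - x‖ ≤ d →
      |MvPolynomial.eval y (mderivList l R)| * d ^ l.length ≤ (1 + n) ^ s * T := by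
  induction s with
  | zero =>
    intro l hl y _
    rw [wf_mderivList_zero hm l R hR (by omega)]
    simpa using hT0
  | succ s ih =>
    intro l hl y hy
    have hx : |MvPolynomial.eval x (mderivList l R)| * d ^ l.length ≤ T := by
      by_cases h : l.length < m
      · exact hT l h
      · rw [wf_mderivList_zero hm l R hR (by omega)]; simpa using hT0
    set B := (1 + (n:ℝ)) ^ s * T / d ^ (l.length + 1) with hB
    have hB0 : 0 ≤ B := by positivity
    have key := wf_mvt x y (mderivList l R) d B hy hB0 (by
      intro z hz i
      rw [hB, le_div_iff₀ (by positivity)]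
      exact ih (i :: l) (by simp only [List.length_cons]; omega) z hz)
    have h3 : |MvPolynomial.eval y (mderivList l R)| ≤
        |MvPolynomial.eval x (mderivList l R)| + n * (d * B) := by
      have := abs_sub_abs_le_abs_sub (MvPolynomial.eval y (mderivList l R))
        (MvPolynomial.eval x (mderivList l R))
      linarith
    have h4 : n * (d * B) * d ^ l.length = n * ((1 + (n:ℝ)) ^ s * T) := by
      rw [hB]; field_simp; ring
    have h5 : T ≤ (1 + (n:ℝ)) ^ s * T := by
      have : (1:ℝ) ≤ (1 + (n:ℝ)) ^ s := one_le_pow₀ (by simp)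
      nlinarith
    calc _ ≤ (|MvPolynomial.eval x (mderivList l R)| + n * (d * B)) * d ^ l.length := by gcongr
      _ ≤ T + n * ((1 + (n:ℝ)) ^ s * T) := by rw [add_mul, h4]; linarith
      _ ≤ (1 + n) ^ (s+1) * T := by rw [pow_succ]; nlinarith

theorem wf_pNorm_nonneg (n m : ℕ) (p : ℝ) (P : MvPolynomial (Fin n) ℝ) (x : Fin n → ℝ) (δ : ℝ)
    (hδ : 0 ≤ δ) : 0 ≤ pNorm n m p P x δ := by
  unfold pNorm; positivity

theorem wf_pNorm_pow (n m : ℕ) (p : ℝ) (hp : 0 < p) (P : MvPolynomial (Fin n) ℝ)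
    (x : Fin n → ℝ) (δ : ℝ) (hδ : 0 ≤ δ) : pNorm n m p P x δ ^ p = ∑ β ∈ multiIndices n m,
      |MvPolynomial.eval x (mderiv β P)| ^ p *
        δ ^ ((n : ℝ) + ((∑ i, β i : ℕ) : ℝ) * p - (m : ℝ) * p) := by
  unfold pNorm
  rw [one_div, Real.rpow_inv_rpow (by positivity) hp.ne']

theorem wf_deriv_le_pNorm (n m : ℕ) (p : ℝ) (hp : 0 < p) (P : MvPolynomial (Fin n) ℝ)
    (x : Fin n → ℝ) (δ : ℝ) (hδ : 0 < δ) (β : Fin n → ℕ) (hβ : β ∈ multiIndices n m) :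
    |MvPolynomial.eval x (mderiv β P)| ≤
      pNorm n m p P x δ * δ ^ ((m : ℝ) - n / p - ((∑ i, β i : ℕ) : ℝ)) := by
  have h := Finset.single_le_sum (f := fun β => |MvPolynomial.eval x (mderiv β P)| ^ p *
        δ ^ ((n : ℝ) + ((∑ i, β i : ℕ) : ℝ) * p - (m : ℝ) * p)) (fun i _ => by positivity) hβ
  rw [← wf_pNorm_pow n m p hp P x δ hδ.le] at h
  have hN := wf_pNorm_nonneg n m p P x δ hδ.le
  rw [← Real.rpow_le_rpow_iff (abs_nonneg _) (by positivity) hp,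
    Real.mul_rpow hN (by positivity), ← Real.rpow_mul hδ.le]
  have e : ((m : ℝ) - n / p - ((∑ i, β i : ℕ) : ℝ)) * p =
      -((n : ℝ) + ((∑ i, β i : ℕ) : ℝ) * p - (m : ℝ) * p) := by field_simp; ring
  rw [e, Real.rpow_neg hδ.le, ← div_eq_mul_inv, le_div_iff₀ (by positivity)]
  exact h

theorem wf_taylor {n m : ℕ} (hm : 1 ≤ m) (p : ℝ) (hp : 0 < p) (R : MvPolynomial (Fin n) ℝ)
    (hR : R.totalDegree ≤ m - 1) (x y : Fin n → ℝ) (ρ d r : ℝ) (hρ : 0 < ρ) (hρd : ρ ≤ d)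
    (hr : pNorm n m p R x ρ ≤ r) (hxy : ‖y - x‖ ≤ d) (β : Fin n → ℕ)
    (hβ : β ∈ multiIndices n m) :
    |MvPolynomial.eval y (mderiv β R)| ≤ (1 + n) ^ m * r * ρ ^ (1 - (n : ℝ) / p) *
      d ^ ((m : ℝ) - 1 - ((∑ i, β i : ℕ) : ℝ)) := by
  have hd : 0 < d := hρ.trans_le hρd
  have hr0 : 0 ≤ r := (wf_pNorm_nonneg n m p R x ρ hρ.le).trans hr
  set T := r * ρ ^ (1 - (n : ℝ) / p) * d ^ ((m : ℝ) - 1) with hT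
  have hT0 : 0 ≤ T := by positivity
  have key := wf_taylor_aux hm R hR x d T hd hT0 (by
    intro l hl
    obtain ⟨h1, h2⟩ := wf_count_mem hm l hl
    have h3 := wf_deriv_le_pNorm n m p hp R x ρ hρ _ h1
    rw [h2] at h3
    have h4 : mderiv (fun i => l.count i) R = mderivList l R :=
      (wf_mderivList_perm (wf_list_count l) R).symm
    rw [h4] at h3
    have hl' : (l.length : ℝ) + 1 ≤ m := by exact_mod_cast hl
    have h5 : ρ ^ ((m : ℝ) - n / p - (l.length : ℝ)) =
        ρ ^ (1 - (n : ℝ) / p) * ρ ^ ((m : ℝ) - 1 - l.length) := by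
      rw [← Real.rpow_add hρ]; congr 1; ring
    have h6 : ρ ^ ((m : ℝ) - 1 - l.length) ≤ d ^ ((m : ℝ) - 1 - l.length) :=
      Real.rpow_le_rpow hρ.le hρd (by linarith)
    have h7 : d ^ ((m : ℝ) - 1 - l.length) * d ^ l.length = d ^ ((m : ℝ) - 1) := by
      rw [← Real.rpow_natCast, ← Real.rpow_add hd]; congr 1; ring
    calc _ ≤ (r * (ρ ^ (1 - (n : ℝ) / p) * d ^ ((m : ℝ) - 1 - l.length))) * d ^ l.length := by
          gcongr
          refine h3.trans ?_
          rw [h5]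
          gcongr
      _ = T := by rw [hT, ← h7]; ring) m (wfList β) (by omega) y hxy
  rw [wf_list_length] at key
  have h7 : d ^ ((m : ℝ) - 1 - ((∑ i, β i : ℕ) : ℝ)) * d ^ (∑ i, β i) = d ^ ((m : ℝ) - 1) := by
    rw [← Real.rpow_natCast, ← Real.rpow_add hd]; congr 1; ring
  have h8 : mderivList (wfList β) R = mderiv β R := rfl
  rw [h8] at key
  have h9 : 0 < d ^ (∑ i, β i) := by positivity
  refine le_of_mul_le_mul_right (key.trans_eq ?_) h9
  rw [hT, ← h7]; ring

/-! ### `ENNReal` facts -/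

theorem wf_holder (p : ℝ) (hp : 1 ≤ p) (w f : ℕ → ℝ≥0∞) :
    (∑' k, w k * f k) ^ p ≤ (∑' k, w k) ^ (p - 1) * ∑' k, w k * f k ^ p := by
  have hp0 : 0 < p := by linarith
  have h : ∑' k, w k * f k ≤ (∑' k, w k) ^ (1 - p⁻¹) * (∑' k, w k * f k ^ p) ^ p⁻¹ := by
    rw [ENNReal.tsum_eq_iSup_sum]
    refine iSup_le fun s => ?_
    refine (ENNReal.inner_le_weight_mul_Lp_of_nonneg s hp w f).trans ?_
    have : 0 ≤ 1 - p⁻¹ := by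
      have := inv_le_one_of_one_le₀ hp
      linarith
    exact mul_le_mul' (ENNReal.rpow_le_rpow (ENNReal.sum_le_tsum s) this)
      (ENNReal.rpow_le_rpow (ENNReal.sum_le_tsum s) (by positivity))
  refine (ENNReal.rpow_le_rpow h hp0.le).trans_eq ?_
  rw [ENNReal.mul_rpow_of_nonneg _ _ hp0.le, ← ENNReal.rpow_mul, ← ENNReal.rpow_mul,
    inv_mul_cancel₀ hp0.ne', ENNReal.rpow_one]
  congr 2
  field_simp

theorem wf_telescope_fin (f : ℕ → ℝ) (L : ℕ) (hL : 1 ≤ L) :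
    ENNReal.ofReal |f 0 - f (L - 1)| ≤
      ∑' k : ℕ, if (k : ℕ∞) + 1 < (L : ℕ∞) then ENNReal.ofReal |f k - f (k + 1)| else 0 := by
  have h := edist_le_range_sum_edist f (L - 1)
  simp only [edist_dist, Real.dist_eq] at h
  refine h.trans ?_
  refine le_trans (le_of_eq ?_) (ENNReal.sum_le_tsum (Finset.range (L - 1)))
  refine Finset.sum_congr rfl fun k hk => ?_
  rw [Finset.mem_range] at hk
  rw [if_pos]
  exact_mod_cast (by omega : k + 1 < L)

theorem wf_telescope_inf (f : ℕ → ℝ) (l : ℝ) (hl : Filter.Tendsto f Filter.atTop (nhds l)) :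
    ENNReal.ofReal |f 0 - l| ≤
      ∑' k : ℕ, if (k : ℕ∞) + 1 < (⊤ : ℕ∞) then ENNReal.ofReal |f k - f (k + 1)| else 0 := by
  have h := edist_le_tsum_of_edist_le_of_tendsto₀ (f := f) (a := l)
    (fun k => ENNReal.ofReal |f k - f (k + 1)|)
    (fun k => by rw [edist_dist, Real.dist_eq]) hl
  rw [edist_dist, Real.dist_eq] at h
  refine h.trans (ENNReal.tsum_le_tsum fun k => ?_)
  rw [if_pos]
  exact_mod_cast ENat.natCast_lt_top (k + 1)

theorem wf_geom_ne_top (K r s : ℝ) (hK : 0 ≤ K) (hr : 0 < r) (hr1 : r < 1) (hs : 0 < s) :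
    ∑' k : ℕ, ENNReal.ofReal ((K * r ^ k) ^ s) ≠ ⊤ := by
  have h : ∀ k : ℕ, (K * r ^ k) ^ s = K ^ s * (r ^ s) ^ k := by
    intro k
    rw [Real.mul_rpow hK (by positivity)]
    congr 1
    rw [← Real.rpow_natCast, ← Real.rpow_natCast, ← Real.rpow_mul hr.le, ← Real.rpow_mul hr.le,
      mul_comm]
  simp only [h]
  have hsum : Summable fun k : ℕ => K ^ s * (r ^ s) ^ k :=
    (summable_geometric_of_lt_one (by positivity) (Real.rpow_lt_one hr.le hr1 hs)).mul_left _
  exact hsum.tsum_ofReal_ne_top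

/-! ### Cubes -/

theorem wf_side_pos {n : ℕ} (Q : DyadicCube n) : 0 < Q.sidelength := by
  unfold DyadicCube.sidelength; positivity

theorem wf_center_mem {n : ℕ} (Q : DyadicCube n) : Q.center ∈ Q.toSet := by
  intro i
  have : (0:ℝ) < 2 ^ Q.k := by positivity
  simp only [DyadicCube.center]
  constructor <;> nlinarith

theorem wf_center_dist {n : ℕ} (Q Q' : DyadicCube n) (C : ℝ) (hC : 1 ≤ C)
    (h : Q'.toSet ⊆ Q.dilate C) : ‖Q.center - Q'.center‖ ≤ C * Q.sidelength := by
  have h0 := wf_side_pos Q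
  have h1 := h (wf_center_mem Q')
  rw [pi_norm_le_iff_of_nonneg (by positivity)]
  intro i
  have := h1 i
  rw [Pi.sub_apply, Real.norm_eq_abs, abs_sub_comm]
  nlinarith

theorem wf_step {n m : ℕ} (hm : 1 ≤ m) (p : ℝ) (hp : 0 < p) (C : ℝ) (hC : 1 ≤ C)
    (R : MvPolynomial (Fin n) ℝ) (hR : R.totalDegree ≤ m - 1) (Q Q' : DyadicCube n)
    (hQ : Q'.toSet ⊆ Q.dilate C) (hs : Q'.sidelength ≤ C * Q.sidelength) (β : Fin n → ℕ)
    (hβ : β ∈ multiIndices n m) :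
    |MvPolynomial.eval Q.center (mderiv β R)| ≤
      ((1 + n) ^ m * C ^ m) * ((Q'.sidelength / Q.sidelength) ^ (1 - (n : ℝ) / p) *
        pNorm n m p R Q'.center Q'.sidelength) *
        Q.sidelength ^ ((m : ℝ) - n / p - ((∑ i, β i : ℕ) : ℝ)) := by
  have hδ := wf_side_pos Q
  have hρ := wf_side_pos Q'
  set δ := Q.sidelength
  set ρ := Q'.sidelength
  have hN := wf_pNorm_nonneg n m p R Q'.center ρ hρ.le
  have h := wf_taylor hm p hp R hR Q'.center Q.center ρ (C * δ) _ hρ hs le_rfl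
    (wf_center_dist Q Q' C hC hQ) β hβ
  refine h.trans ?_
  have hsum : (∑ i, β i) ≤ m - 1 := by
    simp only [multiIndices, Finset.mem_filter] at hβ; exact hβ.2
  have h1 : (C * δ) ^ ((m : ℝ) - 1 - ((∑ i, β i : ℕ) : ℝ)) ≤
      C ^ m * δ ^ ((m : ℝ) - 1 - ((∑ i, β i : ℕ) : ℝ)) := by
    rw [Real.mul_rpow (by linarith) hδ.le, ← Real.rpow_natCast C m]
    gcongr
    have : (0:ℝ) ≤ ((∑ i, β i : ℕ) : ℝ) := by positivity
    linarith
  have h2 : ρ ^ (1 - (n : ℝ) / p) * δ ^ ((m : ℝ) - 1 - ((∑ i, β i : ℕ) : ℝ)) =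
      (ρ / δ) ^ (1 - (n : ℝ) / p) * δ ^ ((m : ℝ) - n / p - ((∑ i, β i : ℕ) : ℝ)) := by
    rw [Real.div_rpow hρ.le hδ.le, div_mul_eq_mul_div, mul_div_assoc, ← Real.rpow_sub hδ]
    congr 2; ring
  calc _ ≤ (1 + (n:ℝ)) ^ m * pNorm n m p R Q'.center ρ * ρ ^ (1 - (n : ℝ) / p) *
        (C ^ m * δ ^ ((m : ℝ) - 1 - ((∑ i, β i : ℕ) : ℝ))) := by gcongr
    _ = (1 + (n:ℝ)) ^ m * C ^ m * pNorm n m p R Q'.center ρ * (ρ ^ (1 - (n : ℝ) / p) *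
        δ ^ ((m : ℝ) - 1 - ((∑ i, β i : ℕ) : ℝ))) := by ring
    _ = _ := by rw [h2]; ring

theorem wf_sub_deg {n m : ℕ} (P Q : MvPolynomial (Fin n) ℝ) (hP : P.totalDegree ≤ m - 1)
    (hQ : Q.totalDegree ≤ m - 1) : (P - Q).totalDegree ≤ m - 1 :=
  (MvPolynomial.totalDegree_sub _ _).trans (max_le hP hQ)

/-- Convergence of the derivatives along an infinite chain. -/
theorem wf_limit {n m : ℕ} (hm : 1 ≤ m) (p : ℝ) (hp : (n : ℝ) < p)
    (T : ℕ → DyadicCube n) (P : ℕ → MvPolynomial (Fin n) ℝ) (Ps : MvPolynomial (Fin n) ℝ)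
    (x' y : Fin n → ℝ) (A : ℝ) (hPs : Ps.totalDegree ≤ m - 1)
    (hP : ∀ k, (P k).totalDegree ≤ m - 1) (hne : ∀ k, x' ≠ (T k).center)
    (hA : ∀ k, pNorm n m p (Ps - P k) x' ‖x' - (T k).center‖ ≤ A)
    (hT : Filter.Tendsto (fun k => (T k).center) Filter.atTop (nhds x'))
    (β : Fin n → ℕ) (hβ : β ∈ multiIndices n m) :
    Filter.Tendsto (fun k => MvPolynomial.eval y (mderiv β (P k))) Filter.atTop
      (nhds (MvPolynomial.eval y (mderiv β Ps))) := by
  have hp0 : 0 < p := lt_of_le_of_lt (Nat.cast_nonneg n) hp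
  have ha : 0 < 1 - (n : ℝ) / p := by rw [sub_pos, div_lt_one hp0]; exact hp
  have hρ : Filter.Tendsto (fun k => ‖x' - (T k).center‖) Filter.atTop (nhds 0) := by
    simpa using (hT.const_sub x').norm
  set d := ‖y - x'‖ + 1 with hd
  rw [tendsto_iff_dist_tendsto_zero]
  have hlim : Filter.Tendsto (fun k => (1 + (n:ℝ)) ^ m * A *
      ‖x' - (T k).center‖ ^ (1 - (n : ℝ) / p) *
      d ^ ((m : ℝ) - 1 - ((∑ i, β i : ℕ) : ℝ))) Filter.atTop (nhds 0) := by
    have h1 := hρ.rpow_const (p := 1 - (n : ℝ) / p) (Or.inr ha.le)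
    rw [Real.zero_rpow ha.ne'] at h1
    simpa using (h1.const_mul ((1 + (n:ℝ)) ^ m * A)).mul_const
      (d ^ ((m : ℝ) - 1 - ((∑ i, β i : ℕ) : ℝ)))
  refine squeeze_zero' (Filter.Eventually.of_forall fun _ => dist_nonneg) ?_ hlim
  have hev : ∀ᶠ k in Filter.atTop, ‖x' - (T k).center‖ < 1 :=
    hρ.eventually_lt_const (by norm_num)
  filter_upwards [hev] with k hk
  have h := wf_taylor hm p hp0 (Ps - P k) (wf_sub_deg _ _ hPs (hP k)) x' y
    ‖x' - (T k).center‖ d A (norm_pos_iff.2 (sub_ne_zero.2 (hne k)))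
    (by have := norm_nonneg (y - x'); linarith) (hA k) (by linarith) β hβ
  rw [wf_mderiv_sub, map_sub] at h
  rw [dist_comm, Real.dist_eq]
  exact h

/-- From pointwise telescoping to a bound on the `p`-th power of the norm. -/
theorem wf_norm_bound {n m : ℕ} (p : ℝ) (hp : 0 < p) (K : ℝ) (hK : 0 ≤ K)
    (R : MvPolynomial (Fin n) ℝ) (x : Fin n → ℝ) (δ : ℝ) (hδ : 0 < δ) (X : ℝ≥0∞)
    (h : ∀ β ∈ multiIndices n m, ENNReal.ofReal |MvPolynomial.eval x (mderiv β R)| ≤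
      ENNReal.ofReal K * X *
        ENNReal.ofReal (δ ^ ((m : ℝ) - n / p - ((∑ i, β i : ℕ) : ℝ)))) :
    ENNReal.ofReal (pNorm n m p R x δ ^ p) ≤
      ((multiIndices n m).card : ℝ≥0∞) * (ENNReal.ofReal K ^ p * X ^ p) := by
  rw [wf_pNorm_pow n m p hp R x δ hδ.le, ENNReal.ofReal_sum_of_nonneg (fun i _ => by positivity)]
  refine le_trans ?_ (nsmul_eq_mul _ _).le
  apply Finset.sum_le_card_nsmul
  intro β hβ
  have e : (n : ℝ) + ((∑ i, β i : ℕ) : ℝ) * p - (m : ℝ) * p =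
    -((m : ℝ) - n / p - ((∑ i, β i : ℕ) : ℝ)) * p := by field_simp; ring
  have hb := h β hβ
  set θ := (m : ℝ) - n / p - ((∑ i, β i : ℕ) : ℝ)
  rw [e, Real.rpow_mul hδ.le, ← Real.mul_rpow (abs_nonneg _) (by positivity),
    ← ENNReal.ofReal_rpow_of_nonneg (by positivity) hp.le, ENNReal.ofReal_mul (abs_nonneg _),
    ← ENNReal.mul_rpow_of_nonneg _ _ hp.le]
  refine ENNReal.rpow_le_rpow ?_ hp.le
  calc _ ≤ ENNReal.ofReal K * X * ENNReal.ofReal (δ ^ θ) * ENNReal.ofReal (δ ^ (-θ)) := by gcongr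
    _ = ENNReal.ofReal K * X := by
      rw [mul_assoc, ← ENNReal.ofReal_mul (by positivity), ← Real.rpow_add hδ]
      simp

/-- Resummation over the cubes whose chain contains `q`. -/
theorem wf_count {n : ℕ} (CZp : DyadicCube n → Prop) (mem : DyadicCube n → Prop)
    (q : DyadicCube n) (C s : ℝ) (M N : ℕ) (hM : C ≤ 2 ^ M) (hs : 0 < s)
    (hle : ∀ Q, CZp Q → mem Q → q.sidelength ≤ C * Q.sidelength)
    (hN : ∀ δ : ℝ, {Q : DyadicCube n | CZp Q ∧ Q.sidelength = δ ∧ mem Q}.Finite ∧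
      {Q : DyadicCube n | CZp Q ∧ Q.sidelength = δ ∧ mem Q}.ncard ≤ N) :
    ∑' Q : {Q : DyadicCube n // CZp Q},
      {Q | mem Q}.indicator (fun Q => ENNReal.ofReal ((q.sidelength / Q.sidelength) ^ s)) Q.1 ≤
    N * ∑' t : ℕ, ENNReal.ofReal ((2 ^ M * (1 / 2 : ℝ) ^ t) ^ s) := by
  set B : ℕ → Set (DyadicCube n) := fun t =>
    {Q : DyadicCube n | CZp Q ∧ Q.sidelength = (2:ℝ) ^ (q.k - M + t) ∧ mem Q} with hB
  set v : ℕ → ℝ≥0∞ := fun t => ENNReal.ofReal ((2 ^ M * (1 / 2 : ℝ) ^ t) ^ s) with hv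
  have h1 : ∀ Q : {Q : DyadicCube n // CZp Q},
      {Q | mem Q}.indicator
        (fun Q => ENNReal.ofReal ((q.sidelength / Q.sidelength) ^ s)) Q.1 ≤
      ∑' t : ℕ, (B t).indicator (fun _ => v t) Q.1 := by
    rintro ⟨Q, hQ⟩
    by_cases hmem : mem Q
    · have h2 := (hle Q hQ hmem).trans (mul_le_mul_of_nonneg_right hM (wf_side_pos Q).le)
      have h3 : q.k ≤ M + Q.k := by
        unfold DyadicCube.sidelength at h2
        rw [← zpow_natCast, ← zpow_add₀ (by norm_num)] at h2
        exact (zpow_le_zpow_iff_right₀ (by norm_num)).1 h2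
      obtain ⟨t, ht⟩ := Int.le.dest h3
      refine le_trans ?_ (ENNReal.le_tsum t)
      have hk : Q.k = q.k - M + t := by omega
      have hQB : Q ∈ B t := ⟨hQ, by unfold DyadicCube.sidelength; rw [hk], hmem⟩
      rw [Set.indicator_of_mem hQB, Set.indicator_of_mem (show Q ∈ {Q | mem Q} from hmem)]
      apply le_of_eq
      simp only [hv, DyadicCube.sidelength]
      congr 2
      rw [hk, zpow_add₀ (by norm_num), zpow_sub₀ (by norm_num), zpow_natCast, zpow_natCast,
        one_div, inv_pow]
      field_simp
    · rw [Set.indicator_of_notMem (show Q ∉ {Q | mem Q} from hmem)]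
      exact zero_le
  refine (ENNReal.tsum_le_tsum h1).trans ?_
  rw [ENNReal.tsum_comm, ← ENNReal.tsum_mul_left]
  refine ENNReal.tsum_le_tsum fun t => ?_
  refine (ENNReal.tsum_comp_le_tsum_of_injective Subtype.val_injective
    ((B t).indicator fun _ => v t)).trans ?_
  obtain ⟨hf, hc⟩ := hN ((2:ℝ) ^ (q.k - M + t))
  have hf' : (B t).Finite := hf
  have hc' : (B t).ncard ≤ N := hc
  rw [tsum_eq_sum (s := hf'.toFinset) (fun Q hQ => Set.indicator_of_notMem (by simpa using hQ) _)]
  rw [Set.ncard_eq_toFinset_card _ hf'] at hc'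
  refine (Finset.sum_le_card_nsmul _ _ (v t) fun Q _ => ?_).trans ?_
  · exact Set.indicator_le_self' (fun _ _ => zero_le) Q
  · rw [nsmul_eq_mul]
    gcongr

/-- **Whitney field gluing bound via telescoping and Hölder.**  Let `(P_i)` be a Whitney field
over the CZ cubes and `(P*_x)_{x∈K_p}` a Whitney field on `K_p` whose combined field lies in
`C^{m−1,1−n/p}` (encoded by the Hölder bounds with constant `A`).  Let `P̄_i = P_{κ(i)}` if the
chain of `Q_i` ends at the keystone cube `Q_{κ(i)}` and `P̄_i = P*_{κ(i)}` if it converges to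
the keystone point `κ(i) ∈ K_p` (encoded by `tgt`).  Then
`Σ_i |P_i − P̄_i|_{x_i,δ_{Q_i}}^p ≤ C' Σ_{j ↔ j'} |P_j − P_{j'}|_{x_j,δ_{Q_j}}^p`,
the right sum being over pairs of neighboring CZ cubes. -/
theorem stmt17 (n m : ℕ) (hn : 1 ≤ n) (hm : 1 ≤ m) (p : ℝ) (hp : (n : ℝ) < p)
    (c C : ℝ) (hc : 0 < c) (hc1 : c < 1) (hC : 1 ≤ C) (N : ℕ) :
    ∃ C' : ℝ, 0 < C' ∧
      ∀ OK : DyadicCube n → Prop, OKmono OK →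
      ∀ (S : DyadicCube n → ℕ → DyadicCube n) (len : DyadicCube n → ℕ∞)
        (tgt : DyadicCube n → DyadicCube n ⊕ (Fin n → ℝ)),
        (∀ Q : DyadicCube n, CZ OK Q →
          S Q 0 = Q ∧
          (∀ k : ℕ, (k : ℕ∞) < len Q → CZ OK (S Q k)) ∧
          (∀ k : ℕ, ((k : ℕ∞) + 1) < len Q →
            (closure (S Q k).toSet ∩ closure (S Q (k + 1)).toSet).Nonempty) ∧
          (∀ ℓ k : ℕ, ℓ ≤ k → (k : ℕ∞) < len Q →
            (S Q k).sidelength ≤ C * c ^ (k - ℓ) * (S Q ℓ).sidelength) ∧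
          ((∃ L : ℕ, 1 ≤ L ∧ len Q = (L : ℕ∞) ∧ Keystone OK (S Q (L - 1)) ∧
              tgt Q = Sum.inl (S Q (L - 1))) ∨
           (len Q = ⊤ ∧ ∃ x' ∈ Kp OK, tgt Q = Sum.inr x' ∧
              Filter.Tendsto (fun k => (S Q k).center) Filter.atTop (nhds x')))) →
        (∀ Q : DyadicCube n, CZ OK Q → ∀ k : ℕ, (k : ℕ∞) < len Q →
          (S Q k).toSet ⊆ Q.dilate C) →
        (∀ Qj : DyadicCube n, CZ OK Qj → ∀ δ : ℝ,
          {Q : DyadicCube n | CZ OK Q ∧ Q.sidelength = δ ∧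
            ∃ k : ℕ, (k : ℕ∞) < len Q ∧ S Q k = Qj}.Finite ∧
          {Q : DyadicCube n | CZ OK Q ∧ Q.sidelength = δ ∧
            ∃ k : ℕ, (k : ℕ∞) < len Q ∧ S Q k = Qj}.ncard ≤ N) →
      ∀ (P : DyadicCube n → MvPolynomial (Fin n) ℝ)
        (Pstar : (Fin n → ℝ) → MvPolynomial (Fin n) ℝ) (A : ℝ), 0 ≤ A →
        (∀ Q : DyadicCube n, CZ OK Q → (P Q).totalDegree ≤ m - 1) →
        (∀ x ∈ Kp OK, (Pstar x).totalDegree ≤ m - 1) →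
        (∀ x ∈ Kp OK, ∀ y ∈ Kp OK, x ≠ y →
          pNorm n m p (Pstar x - Pstar y) x ‖x - y‖ ≤ A) →
        (∀ x ∈ Kp OK, ∀ Q : DyadicCube n, CZ OK Q →
          pNorm n m p (Pstar x - P Q) x ‖x - Q.center‖ ≤ A) →
        (∀ Q Q' : DyadicCube n, CZ OK Q → CZ OK Q' → Q ≠ Q' →
          pNorm n m p (P Q - P Q') Q.center ‖Q.center - Q'.center‖ ≤ A) →
        ∑' Q : {Q : DyadicCube n // CZ OK Q},
            ENNReal.ofReal
              (pNorm n m p (P Q.1 - Sum.elim P Pstar (tgt Q.1)) Q.1.center Q.1.sidelength ^ p)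
          ≤ ENNReal.ofReal C' *
            ∑' e : {e : DyadicCube n × DyadicCube n // CZ OK e.1 ∧ CZ OK e.2 ∧
                (closure e.1.toSet ∩ closure e.2.toSet).Nonempty},
              ENNReal.ofReal
                (pNorm n m p (P e.1.1 - P e.1.2) e.1.1.center e.1.1.sidelength ^ p) := by
  have hp0 : 0 < p := lt_of_le_of_lt (Nat.cast_nonneg n) hp
  have hp1 : 1 ≤ p := le_trans (by exact_mod_cast hn) hp.le
  have ha : 0 < 1 - (n : ℝ) / p := by rw [sub_pos, div_lt_one hp0]; exact hp
  obtain ⟨b, hb⟩ : ∃ b : ℝ, b = (1 - (n : ℝ) / p) / 2 := ⟨_, rfl⟩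
  have hb0 : 0 < b := by rw [hb]; linarith
  have hab : 1 - (n : ℝ) / p = b + b := by rw [hb]; ring
  obtain ⟨M, hM⟩ := pow_unbounded_of_one_lt C (one_lt_two : (1:ℝ) < 2)
  set G : ℝ≥0∞ := ∑' k : ℕ, ENNReal.ofReal ((C * c ^ k) ^ b) with hG
  have hGtop : G ≠ ⊤ := wf_geom_ne_top C c b (by linarith) hc hc1 hb0
  set H : ℝ≥0∞ := N * ∑' t : ℕ, ENNReal.ofReal ((2 ^ M * (1 / 2 : ℝ) ^ t) ^ (b * p)) with hH
  have hHtop : H ≠ ⊤ := ENNReal.mul_ne_top (ENNReal.natCast_ne_top N)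
    (wf_geom_ne_top (2 ^ M) (1 / 2) (b * p) (by positivity) (by norm_num) (by norm_num)
      (by positivity))
  set K : ℝ := (1 + n) ^ m * C ^ m with hK
  have hK0 : 0 ≤ K := by positivity
  set D : ℝ≥0∞ := ((multiIndices n m).card : ℝ≥0∞) *
    (ENNReal.ofReal K ^ p * G ^ (p - 1)) * (G * H) with hD
  have hDtop : D ≠ ⊤ := by
    refine ENNReal.mul_ne_top (ENNReal.mul_ne_top (ENNReal.natCast_ne_top _)
      (ENNReal.mul_ne_top ?_ ?_)) (ENNReal.mul_ne_top hGtop hHtop)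
    · exact ENNReal.rpow_ne_top_of_nonneg hp0.le ENNReal.ofReal_ne_top
    · exact ENNReal.rpow_ne_top_of_nonneg (by linarith) hGtop
  refine ⟨D.toReal + 1, by positivity, ?_⟩
  intro OK _ S len tgt hS hdil hcount P Pstar A _ hPdeg hPsdeg _ hA _
  have hDle : D ≤ ENNReal.ofReal (D.toReal + 1) := by
    rw [← ENNReal.ofReal_toReal hDtop]
    exact ENNReal.ofReal_le_ofReal (by rw [ENNReal.ofReal_toReal hDtop]; linarith)
  refine le_trans ?_ (mul_le_mul_left hDle _)
  -- sidelength bound relative to the start of the chain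
  have hside : ∀ Q, CZ OK Q → ∀ k : ℕ, (k : ℕ∞) < len Q →
      (S Q k).sidelength ≤ C * c ^ k * Q.sidelength := by
    intro Q hQ k hk
    obtain ⟨h0, _, _, h3, _⟩ := hS Q hQ
    have := h3 0 k (Nat.zero_le _) hk
    rwa [h0, Nat.sub_zero] at this
  have hsideC : ∀ Q, CZ OK Q → ∀ k : ℕ, (k : ℕ∞) < len Q →
      (S Q k).sidelength ≤ C * Q.sidelength := by
    intro Q hQ k hk
    refine (hside Q hQ k hk).trans ?_
    have h1 : c ^ k ≤ 1 := pow_le_one₀ hc.le hc1.le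
    have h2 := wf_side_pos Q
    have h3 : C * c ^ k ≤ C := by nlinarith
    exact mul_le_mul_of_nonneg_right h3 h2.le
  have hlt : ∀ (Q : DyadicCube n) (k : ℕ), (k : ℕ∞) + 1 < len Q → (k : ℕ∞) < len Q :=
    fun Q k h => lt_of_le_of_lt le_self_add h
  -- the norm of a difference along the chain
  set r : DyadicCube n → DyadicCube n → ℝ :=
    fun q q' => pNorm n m p (P q - P q') q.center q.sidelength with hr
  have hr0 : ∀ q q', 0 ≤ r q q' := fun q q' => wf_pNorm_nonneg _ _ _ _ _ _ (wf_side_pos q).le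
  -- per-cube bound
  have hcube : ∀ Q, CZ OK Q → ENNReal.ofReal
      (pNorm n m p (P Q - Sum.elim P Pstar (tgt Q)) Q.center Q.sidelength ^ p) ≤
      ((multiIndices n m).card : ℝ≥0∞) * (ENNReal.ofReal K ^ p * (G ^ (p - 1) *
        ∑' k : ℕ, ENNReal.ofReal ((C * c ^ k) ^ b) *
          (if (k : ℕ∞) + 1 < len Q then
            ENNReal.ofReal (((S Q k).sidelength / Q.sidelength) ^ (b * p)) *
              ENNReal.ofReal (r (S Q k) (S Q (k + 1)) ^ p) else 0))) := by
    intro Q hQ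
    obtain ⟨h0, h1, h2, h3, h4⟩ := hS Q hQ
    have hδ := wf_side_pos Q
    set X : ℝ≥0∞ := ∑' k : ℕ, if (k : ℕ∞) + 1 < len Q then
      ENNReal.ofReal (((S Q k).sidelength / Q.sidelength) ^ (1 - (n : ℝ) / p) *
        r (S Q k) (S Q (k + 1))) else 0 with hX
    have htel : ∀ β ∈ multiIndices n m, ENNReal.ofReal
        |MvPolynomial.eval Q.center (mderiv β (P Q - Sum.elim P Pstar (tgt Q)))| ≤
        ∑' k : ℕ, if (k : ℕ∞) + 1 < len Q then ENNReal.ofReal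
          |MvPolynomial.eval Q.center (mderiv β (P (S Q k) - P (S Q (k + 1))))| else 0 := by
      intro β hβ
      simp only [wf_mderiv_sub, map_sub]
      rcases h4 with ⟨L, hL, hlen, _, htgt⟩ | ⟨hlen, x', hx', htgt, hlim⟩
      · have := wf_telescope_fin
          (fun k => MvPolynomial.eval Q.center (mderiv β (P (S Q k)))) L hL
        rw [hlen, htgt]
        simpa only [h0, Sum.elim_inl] using this
      · have hcz : ∀ k : ℕ, CZ OK (S Q k) := fun k => h1 k (by
          rw [hlen]; exact ENat.natCast_lt_top k)
        have hconv := wf_limit hm p hp (S Q) (fun k => P (S Q k)) (Pstar x') x' Q.center A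
          (hPsdeg x' hx') (fun k => hPdeg _ (hcz k)) (by
            intro k hk
            apply hx'.2
            refine Set.mem_iUnion₂.2 ⟨S Q k, hcz k, ?_⟩
            rw [hk]
            exact wf_center_mem _) (fun k => hA x' hx' _ (hcz k)) hlim β hβ
        have := wf_telescope_inf _ _ hconv
        rw [hlen, htgt]
        simpa only [h0, Sum.elim_inr] using this
    have hnb := wf_norm_bound (m := m) p hp0 K hK0 (P Q - Sum.elim P Pstar (tgt Q)) Q.center
      Q.sidelength hδ X (by
        intro β hβ
        refine (htel β hβ).trans ?_
        rw [hX, ← ENNReal.tsum_mul_left, ← ENNReal.tsum_mul_right]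
        refine ENNReal.tsum_le_tsum fun k => ?_
        split_ifs with hk
        · have hk' := hlt Q k hk
          rw [← ENNReal.ofReal_mul hK0, ← ENNReal.ofReal_mul (mul_nonneg hK0
            (mul_nonneg (Real.rpow_nonneg (div_nonneg (wf_side_pos _).le hδ.le) _) (hr0 _ _)))]
          apply ENNReal.ofReal_le_ofReal
          exact wf_step hm p hp0 C hC _ (wf_sub_deg _ _ (hPdeg _ (h1 k hk'))
            (hPdeg _ (h1 (k + 1) (by exact_mod_cast hk)))) Q (S Q k) (hdil Q hQ k hk')
            (hsideC Q hQ k hk') β hβ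
        · exact zero_le)
    refine hnb.trans ?_
    refine mul_le_mul_right (mul_le_mul_right ?_ _) _
    -- Hölder
    have hXle : X ≤ ∑' k : ℕ, ENNReal.ofReal ((C * c ^ k) ^ b) *
        (if (k : ℕ∞) + 1 < len Q then
          ENNReal.ofReal (((S Q k).sidelength / Q.sidelength) ^ b * r (S Q k) (S Q (k + 1)))
          else 0) := by
      rw [hX]
      refine ENNReal.tsum_le_tsum fun k => ?_
      split_ifs with hk
      · have hρ := wf_side_pos (S Q k)
        have hCk : 0 ≤ C * c ^ k := by positivity
        rw [← ENNReal.ofReal_mul (by positivity)]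
        apply ENNReal.ofReal_le_ofReal
        have hq : 0 < (S Q k).sidelength / Q.sidelength := by positivity
        rw [hab, Real.rpow_add hq, ← mul_assoc]
        have hle : ((S Q k).sidelength / Q.sidelength) ^ b ≤ (C * c ^ k) ^ b := by
          refine Real.rpow_le_rpow hq.le ?_ hb0.le
          rw [div_le_iff₀ hδ]
          exact hside Q hQ k (hlt Q k hk)
        refine mul_le_mul_of_nonneg_right ?_ (hr0 _ _)
        exact mul_le_mul_of_nonneg_right hle (by positivity)
      · exact zero_le
    refine (ENNReal.rpow_le_rpow hXle hp0.le).trans ?_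
    refine (wf_holder p hp1 _ _).trans_eq ?_
    congr 1
    refine tsum_congr fun k => ?_
    congr 1
    split_ifs with hk
    · have hρ := wf_side_pos (S Q k)
      have hq : 0 < (S Q k).sidelength / Q.sidelength := by positivity
      have := hr0 (S Q k) (S Q (k + 1))
      rw [ENNReal.ofReal_rpow_of_nonneg (by positivity) hp0.le,
        Real.mul_rpow (by positivity) this, ← Real.rpow_mul hq.le,
        ENNReal.ofReal_mul (by positivity)]
    · exact ENNReal.zero_rpow_of_pos hp0
  refine (ENNReal.tsum_le_tsum fun Q : {Q : DyadicCube n // CZ OK Q} => hcube Q.1 Q.2).trans ?_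
  rw [ENNReal.tsum_mul_left, ENNReal.tsum_mul_left, ENNReal.tsum_mul_left, hD]
  simp only [← mul_assoc]
  simp only [mul_assoc ((((multiIndices n m).card : ℝ≥0∞) * ENNReal.ofReal K ^ p) * G ^ (p - 1))]
  refine mul_le_mul_right ?_ _
  -- resummation
  set g : ℕ → ℝ≥0∞ := fun k => ENNReal.ofReal ((C * c ^ k) ^ b) with hg
  set mem : DyadicCube n → DyadicCube n → Prop :=
    fun q Q => ∃ k : ℕ, (k : ℕ∞) < len Q ∧ S Q k = q with hmem
  set U : DyadicCube n → DyadicCube n → ℝ≥0∞ := fun q =>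
    {Q | mem q Q}.indicator
      (fun Q => ENNReal.ofReal ((q.sidelength / Q.sidelength) ^ (b * p))) with hU
  have hpt : ∀ (Q : {Q : DyadicCube n // CZ OK Q}) (k : ℕ),
      g k * (if (k : ℕ∞) + 1 < len Q.1 then
            ENNReal.ofReal (((S Q.1 k).sidelength / Q.1.sidelength) ^ (b * p)) *
              ENNReal.ofReal (r (S Q.1 k) (S Q.1 (k + 1)) ^ p) else 0) ≤
      ∑' e : {e : DyadicCube n × DyadicCube n // CZ OK e.1 ∧ CZ OK e.2 ∧
                (closure e.1.toSet ∩ closure e.2.toSet).Nonempty},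
        g k * (U e.1.1 Q.1 * ENNReal.ofReal (r e.1.1 e.1.2 ^ p)) := by
    rintro ⟨Q, hQ⟩ k
    dsimp only
    split_ifs with hk
    · obtain ⟨h0, h1, h2, h3, h4⟩ := hS Q hQ
      have hk' := hlt Q k hk
      refine le_trans ?_ (ENNReal.le_tsum ⟨(S Q k, S Q (k + 1)),
        h1 k hk', h1 (k + 1) (by exact_mod_cast hk), h2 k hk⟩)
      dsimp only
      rw [hU]
      dsimp only
      rw [Set.indicator_of_mem (show Q ∈ {Q' | mem (S Q k) Q'} from ⟨k, hk', rfl⟩)]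
    · simp
  refine (ENNReal.tsum_le_tsum fun Q => ENNReal.tsum_le_tsum fun k => hpt Q k).trans ?_
  simp only [ENNReal.tsum_mul_left, ENNReal.tsum_mul_right]
  rw [← hG, ENNReal.tsum_comm]
  simp only [ENNReal.tsum_mul_right]
  rw [mul_assoc]
  refine mul_le_mul_right ?_ _
  rw [← ENNReal.tsum_mul_left]
  refine ENNReal.tsum_le_tsum fun e => ?_
  refine mul_le_mul_left ?_ _
  refine wf_count (CZ OK) (mem e.1.1) e.1.1 C (b * p) M N hM.le (by positivity) ?_ ?_
  · rintro Q hQ ⟨k, hk, hke⟩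
    rw [← hke]
    exact hsideC Q hQ k hk
  · exact hcount e.1.1 e.2.1

end
end
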